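/- For every integer k ≥ 2, the abelianization of the fundamental group of F_{k+1}^{1,1} is isomorphic to ℤ^{m} × (ℤ/2ℤ), where m = (k choose 2) − 1. -/

import Mathlib

noncomputable section

open Module Submodule

/-- Topology on the projectivization (quotient topology). -/
instance (K V : Type*) [DivisionRing K] [AddCommGroup V] [Module K V] [TopologicalSpace V] :
    TopologicalSpace (Projectivization K V) :=
  inferInstanceAs (TopologicalSpace (Quotient (projectivizationSetoid K V)))

/-- The complex projective space `ℂP^n`. -/
abbrev CP (n : ℕ) := Projectivization ℂ (Fin (n + 1) → ℂ)

/-- `Fconf k i n` is the ordered configuration space `F_k^{i,n}` of `k` pairwise distinct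
points of `ℂP^n` whose projective span has dimension `i` (i.e. the span of representative
vectors has linear dimension `i + 1`). -/
def Fconf (k i n : ℕ) : Set (Fin k → CP n) :=
  {x | Function.Injective x ∧
    finrank ℂ (span ℂ (Set.range fun j => (x j).rep)) = i + 1}

section Auxiliary

open scoped Topology unitInterval

/-- `u` is a local primitive of the two-point function `c` at every point of `U`. -/
def IsPotential {X A : Type*} [TopologicalSpace X] [AddCommGroup A] (c : X → X → A) (u : X → A)
    (U : Set X) : Prop :=
  ∀ p ∈ U, ∃ W ∈ 𝓝 p, ∀ x ∈ W, ∀ y ∈ W, c x y = u y - u x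

/-- The two-point function `c` has a primitive near every point of `U`: it is a `1`-cocycle in the
sense of Alexander and Spanier. -/
def IsLocalCocycle {X A : Type*} [TopologicalSpace X] [AddCommGroup A] (c : X → X → A)
    (U : Set X) : Prop :=
  ∀ p ∈ U, ∃ W ∈ 𝓝 p, ∃ u : X → A, ∀ x ∈ W, ∀ y ∈ W, c x y = u y - u x

section LocalCocycle

variable {X Y A : Type*} [TopologicalSpace X] [TopologicalSpace Y] [AddCommGroup A]
  {c d : X → X → A} {u v : X → A} {U V : Set X}

theorem IsPotential.mono (h : IsPotential c u U) (hVU : V ⊆ U) : IsPotential c u V :=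
  fun p hp => h p (hVU hp)

theorem IsLocalCocycle.mono (h : IsLocalCocycle c U) (hVU : V ⊆ U) : IsLocalCocycle c V :=
  fun p hp => h p (hVU hp)

theorem IsPotential.comp (h : IsPotential c u U) {f : Y → X} {T : Set Y}
    (hf : ∀ y ∈ T, ContinuousAt f y) (hT : Set.MapsTo f T U) :
    IsPotential (fun x y => c (f x) (f y)) (u ∘ f) T := by
  intro p hp
  obtain ⟨W, hW, hu⟩ := h (f p) (hT hp)
  exact ⟨f ⁻¹' W, (hf p hp) hW, fun x hx y hy => hu _ hx _ hy⟩

theorem IsLocalCocycle.comp (h : IsLocalCocycle c U) {f : Y → X} {T : Set Y}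
    (hf : ∀ y ∈ T, ContinuousAt f y) (hT : Set.MapsTo f T U) :
    IsLocalCocycle (fun x y => c (f x) (f y)) T := by
  intro p hp
  obtain ⟨W, hW, u, hu⟩ := h (f p) (hT hp)
  exact ⟨f ⁻¹' W, (hf p hp) hW, u ∘ f, fun x hx y hy => hu _ hx _ hy⟩

theorem IsPotential.add (h : IsPotential c u U) (k : IsPotential d v U) :
    IsPotential (fun x y => c x y + d x y) (fun x => u x + v x) U := by
  intro p hp
  obtain ⟨W, hW, hu⟩ := h p hp
  obtain ⟨W', hW', hv⟩ := k p hp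
  refine ⟨W ∩ W', Filter.inter_mem hW hW', fun x hx y hy => ?_⟩
  simp only [hu x hx.1 y hy.1, hv x hx.2 y hy.2]
  abel

theorem IsPotential.sub (h : IsPotential c u U) (k : IsPotential d v U) :
    IsPotential (fun x y => c x y - d x y) (fun x => u x - v x) U := by
  intro p hp
  obtain ⟨W, hW, hu⟩ := h p hp
  obtain ⟨W', hW', hv⟩ := k p hp
  refine ⟨W ∩ W', Filter.inter_mem hW hW', fun x hx y hy => ?_⟩
  simp only [hu x hx.1 y hy.1, hv x hx.2 y hy.2]
  abel

theorem IsLocalCocycle.sub (h : IsLocalCocycle c U) (k : IsLocalCocycle d U) :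
    IsLocalCocycle (fun x y => c x y - d x y) U := by
  intro p hp
  obtain ⟨W, hW, u, hu⟩ := h p hp
  obtain ⟨W', hW', v, hv⟩ := k p hp
  refine ⟨W ∩ W', Filter.inter_mem hW hW', fun x => u x - v x, fun x hx y hy => ?_⟩
  simp only [hu x hx.1 y hy.1, hv x hx.2 y hy.2]
  abel

theorem IsPotential.zsmul {n : X → X → ℤ} {m : X → ℤ} (h : IsPotential n m U) (a : A) :
    IsPotential (fun x y => n x y • a) (fun x => m x • a) U := by
  intro p hp
  obtain ⟨W, hW, hu⟩ := h p hp
  exact ⟨W, hW, fun x hx y hy => by simp only [hu x hx y hy, sub_smul]⟩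

theorem IsLocalCocycle.zsmul {n : X → X → ℤ} (h : IsLocalCocycle n U) (a : A) :
    IsLocalCocycle (fun x y => n x y • a) U := by
  intro p hp
  obtain ⟨W, hW, m, hu⟩ := h p hp
  exact ⟨W, hW, fun x => m x • a, fun x hx y hy => by simp only [hu x hx y hy, sub_smul]⟩

theorem IsPotential.finset_sum {ι : Type*} (s : Finset ι) {c : ι → X → X → A} {u : ι → X → A}
    (h : ∀ i ∈ s, IsPotential (c i) (u i) U) :
    IsPotential (fun x y => ∑ i ∈ s, c i x y) (fun x => ∑ i ∈ s, u i x) U := by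
  classical
  induction s using Finset.induction_on with
  | empty => exact fun p _ => ⟨Set.univ, Filter.univ_mem, by simp⟩
  | insert i s hi ih =>
    simp only [Finset.sum_insert hi]
    exact (h i (Finset.mem_insert_self i s)).add
      (ih fun j hj => h j (Finset.mem_insert_of_mem hj))

/-- Two primitives of the same cocycle differ by a constant on a preconnected set. -/
theorem IsPotential.sub_eq_sub (h : IsPotential c u U) (k : IsPotential c v U)
    (hU : IsPreconnected U) {x y : X} (hx : x ∈ U) (hy : y ∈ U) : u x - v x = u y - v y := by
  let : TopologicalSpace A := ⊥
  have : DiscreteTopology A := ⟨rfl⟩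
  refine hU.constant (f := fun z => u z - v z) (fun p hp => ?_) hx hy
  refine ContinuousAt.continuousWithinAt ?_
  obtain ⟨W, hW, hu⟩ := h p hp
  obtain ⟨W', hW', hv⟩ := k p hp
  refine (continuousAt_const (y := u p - v p)).congr ?_
  filter_upwards [hW, hW'] with q hq hq'
  have h1 := hu p (mem_of_mem_nhds hW) q hq
  rw [hv p (mem_of_mem_nhds hW') q hq'] at h1
  rw [sub_eq_sub_iff_add_eq_add] at h1 ⊢
  rw [add_comm, h1.symm, add_comm]

/-- On a simply connected space, every local cocycle has a global primitive. -/
theorem IsLocalCocycle.exists_isPotential [SimplyConnectedSpace X] [LocallyPathConnectedSpace X]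
    (h : IsLocalCocycle c Set.univ) : ∃ u, IsPotential c u Set.univ := by
  have h' : ∀ p : X, ∃ W : Set X, IsOpen W ∧ p ∈ W ∧ ∃ u : X → A,
      ∀ x ∈ W, ∀ y ∈ W, c x y = u y - u x := by
    intro p
    obtain ⟨W, hW, u, hu⟩ := h p (Set.mem_univ p)
    obtain ⟨W', hW', ho, hp⟩ := mem_nhds_iff.1 hW
    exact ⟨W', ho, hp, u, fun x hx y hy => hu x (hW' hx) y (hW' hy)⟩
  choose W hWo hWp u hu using h'
  let : TopologicalSpace A := ⊥
  have : DiscreteTopology A := ⟨rfl⟩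
  let Z : FiberBundleCore X X A :=
    { baseSet := W
      isOpen_baseSet := hWo
      indexAt := id
      mem_baseSet_at := hWp
      coordChange := fun p q x a => a + (u p x - u q x)
      coordChange_self := by intros; simp
      continuousOn_coordChange := by
        intro p q
        rintro ⟨x, a⟩ ⟨⟨hxp, hxq⟩, -⟩
        refine ContinuousAt.continuousWithinAt ?_
        refine ContinuousAt.congr (f := fun z : X × A => z.2 + (u p x - u q x)) ?_ ?_
        · exact (continuous_of_discreteTopology (f := fun a => a + (u p x - u q x))).continuousAt.comp
            continuousAt_snd
        · have : W p ×ˢ Set.univ ∩ W q ×ˢ Set.univ ∈ 𝓝 (x, a) := by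
            refine Filter.inter_mem ?_ ?_ <;>
              exact prod_mem_nhds ((hWo _).mem_nhds (by assumption)) Filter.univ_mem
          filter_upwards [this]
          rintro ⟨y, b⟩ ⟨⟨hyp, -⟩, ⟨hyq, -⟩⟩
          have h1 := hu p x hxp y hyp
          rw [hu q x hxq y hyq] at h1
          have h2 : u p x - u q x = u p y - u q y := by
            rw [sub_eq_sub_iff_add_eq_add] at h1 ⊢
            rw [add_comm, h1.symm, add_comm]
          simp only [h2]
      coordChange_comp := by intros; abel }
  have cov : IsCoveringMap (Bundle.TotalSpace.proj : Z.TotalSpace → X) :=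
    FiberBundle.isCoveringMap (F := A) (E := Z.Fiber)
  obtain ⟨x₀⟩ : Nonempty X := inferInstance
  obtain ⟨F, ⟨-, hF⟩, -⟩ := cov.existsUnique_continuousMap_lifts (ContinuousMap.id X) x₀
    ⟨x₀, (0 : A)⟩ rfl
  have hF' : ∀ x, (F x).proj = x := fun x => congr_fun hF x
  refine ⟨fun x => (show A from (F x).2) + u x x, fun p _ => ?_⟩
  have hc : ContinuousAt (fun x => (Z.localTriv p (F x)).2) p := by
    refine continuous_snd.continuousAt.comp (ContinuousAt.comp ?_ F.continuous.continuousAt)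
    refine (Z.localTriv p).continuousAt ?_
    rw [FiberBundleCore.mem_localTriv_source, hF']
    exact hWp p
  have hloc := hc.eventually (show ∀ᶠ a in 𝓝 _, a = _ from by rw [nhds_discrete]; exact rfl)
  refine ⟨_, Filter.inter_mem hloc ((hWo p).mem_nhds (hWp p)), ?_⟩
  rintro x ⟨hx, hxW⟩ y ⟨hy, hyW⟩
  have key : ∀ z, (Z.localTriv p (F z)).2 = (show A from (F z).2) + (u z z - u p z) := by
    intro z
    have hz := hF' z
    generalize F z = q at hz ⊢
    obtain ⟨y, a⟩ := q
    subst hz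
    rfl
  have e : _ = _ := hx.trans hy.symm
  rw [key, key] at e
  rw [hu p x hxW y hyW]
  have : (show A from (F x).2) + u x x - u p x = (show A from (F y).2) + u y y - u p y := by
    rw [add_sub_assoc, add_sub_assoc]; exact e
  rw [sub_eq_sub_iff_add_eq_add] at this ⊢
  rw [add_comm, this.symm]

end LocalCocycle

section Integral

variable {X Y A : Type*} [TopologicalSpace X] [TopologicalSpace Y] [AddCommGroup A]
  {c d : X → X → A} {u v : X → A} {U V : Set X}

theorem IsLocalCocycle.exists_isPotential_unitInterval {c : I → I → A}
    (h : IsLocalCocycle c Set.univ) : ∃ u, IsPotential c u Set.univ := by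
  have hp : Continuous (Set.projIcc (0 : ℝ) 1 zero_le_one) := continuous_projIcc
  obtain ⟨u, hu⟩ := (h.comp (f := Set.projIcc (0 : ℝ) 1 zero_le_one) (T := Set.univ)
    (fun _ _ => hp.continuousAt) (fun _ _ => trivial)).exists_isPotential
  refine ⟨u ∘ Subtype.val, ?_⟩
  have := hu.comp (f := (Subtype.val : I → ℝ)) (T := Set.univ)
    (fun _ _ => continuous_subtype_val.continuousAt) (fun _ _ => trivial)
  simpa using this

theorem IsLocalCocycle.exists_isPotential_square {c : I × I → I × I → A}
    (h : IsLocalCocycle c Set.univ) : ∃ u, IsPotential c u Set.univ := by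
  have hp : Continuous (Prod.map (Set.projIcc (0 : ℝ) 1 zero_le_one)
    (Set.projIcc (0 : ℝ) 1 zero_le_one)) := continuous_projIcc.prodMap continuous_projIcc
  obtain ⟨u, hu⟩ := (h.comp (T := Set.univ)
    (fun _ _ => hp.continuousAt) (fun _ _ => trivial)).exists_isPotential
  refine ⟨u ∘ Prod.map Subtype.val Subtype.val, ?_⟩
  have := hu.comp (f := (Prod.map Subtype.val Subtype.val : I × I → ℝ × ℝ)) (T := Set.univ)
    (fun _ _ => (continuous_subtype_val.prodMap continuous_subtype_val).continuousAt)
    (fun _ _ => trivial)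
  simpa [Prod.map] using this

theorem IsLocalCocycle.comp_continuous (h : IsLocalCocycle c Set.univ) {f : Y → X}
    (hf : Continuous f) : IsLocalCocycle (fun x y => c (f x) (f y)) Set.univ :=
  h.comp (fun _ _ => hf.continuousAt) (fun _ _ => trivial)

theorem IsPotential.comp_continuous (h : IsPotential c u Set.univ) {f : Y → X}
    (hf : Continuous f) : IsPotential (fun x y => c (f x) (f y)) (u ∘ f) Set.univ :=
  h.comp (fun _ _ => hf.continuousAt) (fun _ _ => trivial)

open Classical in
/-- The integral of a local cocycle along a path. -/
def cocycleIntegral (c : X → X → A) (γ : I → X) : A :=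
  if h : ∃ v : I → A, IsPotential (fun s t => c (γ s) (γ t)) v Set.univ then
    h.choose 1 - h.choose 0 else 0

theorem cocycleIntegral_eq {X : Type*} {c : X → X → A} {γ : I → X} {v : I → A}
    (hv : IsPotential (fun s t => c (γ s) (γ t)) v Set.univ) :
    cocycleIntegral c γ = v 1 - v 0 := by
  have h : ∃ v : I → A, IsPotential (fun s t => c (γ s) (γ t)) v Set.univ := ⟨v, hv⟩
  rw [cocycleIntegral, dif_pos h]
  have := h.choose_spec.sub_eq_sub hv isPreconnected_univ (Set.mem_univ 1) (Set.mem_univ 0)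
  rw [sub_eq_sub_iff_add_eq_add] at this ⊢
  rw [this, add_comm]

theorem cocycleIntegral_zsmul_sum {ι : Type*} (s : Finset ι) {n : ι → X → X → ℤ} {a : ι → A}
    (hn : ∀ i ∈ s, IsLocalCocycle (n i) Set.univ) {γ : I → X} (hγ : Continuous γ) :
    cocycleIntegral (fun x y => ∑ i ∈ s, n i x y • a i) γ =
      ∑ i ∈ s, cocycleIntegral (n i) γ • a i := by
  have h : ∀ i, ∃ v : I → ℤ, i ∈ s → IsPotential (fun x y => n i (γ x) (γ y)) v Set.univ := by
    intro i
    by_cases hi : i ∈ s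
    · obtain ⟨v, hv⟩ := ((hn i hi).comp_continuous hγ).exists_isPotential_unitInterval
      exact ⟨v, fun _ => hv⟩
    · exact ⟨0, fun h => absurd h hi⟩
  choose v hv using h
  rw [cocycleIntegral_eq (IsPotential.finset_sum s fun i hi => (hv i hi).zsmul (a i)),
    ← Finset.sum_sub_distrib]
  exact Finset.sum_congr rfl fun i hi => by rw [cocycleIntegral_eq (hv i hi), sub_smul]

theorem IsLocalCocycle.apply_self (h : IsLocalCocycle c Set.univ) (x : X) : c x x = 0 := by
  obtain ⟨W, hW, u, hu⟩ := h x trivial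
  rw [hu x (mem_of_mem_nhds hW) x (mem_of_mem_nhds hW), sub_self]

theorem IsLocalCocycle.cocycleIntegral_const (h : IsLocalCocycle c Set.univ) (x : X) :
    cocycleIntegral c (fun _ => x) = 0 := by
  rw [cocycleIntegral_eq (v := 0)]
  · simp
  · exact fun p _ => ⟨Set.univ, Filter.univ_mem, by simp [h.apply_self]⟩

theorem IsLocalCocycle.cocycleIntegral_trans (h : IsLocalCocycle c Set.univ) {x y z : X}
    (γ : Path x y) (γ' : Path y z) :
    cocycleIntegral c (γ.trans γ') = cocycleIntegral c γ + cocycleIntegral c γ' := by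
  obtain ⟨v, hv⟩ := (h.comp_continuous (γ.trans γ').continuous).exists_isPotential_unitInterval
  have hl (t : I) : ((t : ℝ) / 2) ∈ I := ⟨by linarith [t.2.1], by linarith [t.2.2]⟩
  have hr (t : I) : ((t : ℝ) + 1) / 2 ∈ I := ⟨by linarith [t.2.1], by linarith [t.2.2]⟩
  have el (t : I) : γ.trans γ' ⟨_, hl t⟩ = γ t := by
    rw [Path.trans_apply, dif_pos (by simp only; linarith [t.2.2])]
    congr 1; ext; simp only; ring
  have er (t : I) : γ.trans γ' ⟨_, hr t⟩ = γ' t := by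
    rw [Path.trans_apply]
    split_ifs with h
    · obtain rfl : t = 0 := Subtype.ext (le_antisymm (by simp only at h; simp; linarith) t.2.1)
      simp
    · congr 1; ext; simp only; ring
  have h1 : IsPotential (fun s t => c (γ s) (γ t)) (fun t => v ⟨_, hl t⟩) Set.univ := by
    have := hv.comp_continuous (f := fun t : I => (⟨_, hl t⟩ : I)) (by fun_prop)
    simp only [el] at this
    exact this
  have h2 : IsPotential (fun s t => c (γ' s) (γ' t)) (fun t => v ⟨_, hr t⟩) Set.univ := by
    have := hv.comp_continuous (f := fun t : I => (⟨_, hr t⟩ : I)) (by fun_prop)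
    simp only [er] at this
    exact this
  rw [cocycleIntegral_eq hv, cocycleIntegral_eq h1, cocycleIntegral_eq h2]
  have e1 : (⟨_, hl 1⟩ : I) = ⟨_, hr 0⟩ := by ext; simp
  have e2 : (⟨_, hl 0⟩ : I) = 0 := by ext; simp
  have e3 : (⟨_, hr 1⟩ : I) = 1 := by ext; simp
  rw [e1, e2, e3]
  abel

theorem IsLocalCocycle.cocycleIntegral_eq_of_homotopic (h : IsLocalCocycle c Set.univ) {x y : X}
    {γ γ' : Path x y} (H : γ.Homotopic γ') : cocycleIntegral c γ = cocycleIntegral c γ' := by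
  obtain ⟨F⟩ := H
  obtain ⟨v, hv⟩ := (h.comp_continuous F.continuous).exists_isPotential_square
  have key (f : I → I × I) (hf : Continuous f) :
      cocycleIntegral c (fun t => F (f t)) = v (f 1) - v (f 0) :=
    _root_.cocycleIntegral_eq (hv.comp_continuous hf)
  have h0 := key (fun t => (0, t)) (by fun_prop)
  have h1 := key (fun t => (1, t)) (by fun_prop)
  have h2 := key (fun t => (t, 0)) (by fun_prop)
  have h3 := key (fun t => (t, 1)) (by fun_prop)
  simp only [Path.Homotopy.source, Path.Homotopy.target, h.cocycleIntegral_const] at h2 h3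
  simp only [ContinuousMap.HomotopyWith.apply_zero, ContinuousMap.HomotopyWith.apply_one] at h0 h1
  change cocycleIntegral c γ = _ at h0
  change cocycleIntegral c γ' = _ at h1
  rw [h0, h1, sub_eq_zero.1 h2.symm, sub_eq_zero.1 h3.symm]

/-- The homomorphism from the fundamental group given by integrating a local cocycle. -/
def IsLocalCocycle.integralHom (h : IsLocalCocycle c Set.univ) (x : X) :
    FundamentalGroup X x →* Multiplicative A where
  toFun q := Multiplicative.ofAdd (Quotient.lift (fun γ : Path x x => cocycleIntegral c γ)
    (fun _ _ H => h.cocycleIntegral_eq_of_homotopic H) q.toPath)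
  map_one' := congrArg Multiplicative.ofAdd (h.cocycleIntegral_const x)
  map_mul' p q := by
    induction p using Path.Homotopic.Quotient.ind with | _ p
    induction q using Path.Homotopic.Quotient.ind with | _ q
    exact congrArg Multiplicative.ofAdd
      ((h.cocycleIntegral_trans q p).trans (add_comm _ _))

/-- An additive function on path classes. -/
def IsAdditiveOnPaths (ψ : ∀ {x y : X}, Path x y → A) : Prop :=
  (∀ {x y : X} {γ γ' : Path x y}, γ.Homotopic γ' → ψ γ = ψ γ') ∧
    ∀ {x y z : X} (γ : Path x y) (γ' : Path y z), ψ (γ.trans γ') = ψ γ + ψ γ'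

open CategoryTheory in
/-- A homomorphism from the fundamental group of a path-connected space to an abelian group
extends to an additive function on path classes. -/
theorem exists_isAdditiveOnPaths [PathConnectedSpace X] {x₀ : X}
    (φ : FundamentalGroup X x₀ →* Multiplicative A) :
    ∃ ψ : ∀ {x y : X}, Path x y → A, IsAdditiveOnPaths @ψ ∧
      ∀ γ : Path x₀ x₀, Multiplicative.ofAdd (ψ γ) = φ (FundamentalGroup.fromPath (.mk γ)) := by
  let P (x : X) : FundamentalGroupoid.mk x₀ ⟶ FundamentalGroupoid.mk x :=
    Path.Homotopic.Quotient.mk (PathConnectedSpace.somePath x₀ x)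
  let Q {x y : X} (γ : Path x y) : FundamentalGroupoid.mk x ⟶ FundamentalGroupoid.mk y :=
    Path.Homotopic.Quotient.mk γ
  have hQ {x y z : X} (γ : Path x y) (γ' : Path y z) : Q (γ.trans γ') = Q γ ≫ Q γ' := rfl
  have hφ (f g : FundamentalGroupoid.mk x₀ ⟶ FundamentalGroupoid.mk x₀) :
      φ (f ≫ g) = φ f * φ g := (φ.map_mul g f).trans (mul_comm _ _)
  have hφi (f : FundamentalGroupoid.mk x₀ ⟶ FundamentalGroupoid.mk x₀) :
      φ (inv f) = (φ f)⁻¹ := by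
    rw [eq_inv_iff_mul_eq_one, ← hφ, IsIso.inv_hom_id]
    exact map_one φ
  refine ⟨fun {x y} γ => Multiplicative.toAdd (φ (P x ≫ Q γ ≫ inv (P y))), ⟨?_, ?_⟩, ?_⟩
  · intro x y γ γ' h
    have : Q γ = Q γ' := Path.Homotopic.Quotient.eq.2 h
    simp only [this]
  · intro x y z γ γ'
    simp only [← toAdd_mul, ← hφ, hQ]
    simp
  · intro γ
    simp only [ofAdd_toAdd, hφ, hφi]
    rw [mul_comm, mul_assoc, inv_mul_cancel, mul_one]

end Integral

section Segments

variable {E A : Type*} [NormedAddCommGroup E] [NormedSpace ℝ E] [AddCommGroup A] {M : Set E}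

/-- Two paths with the same endpoints inside a convex set are homotopic. -/
theorem Path.homotopic_of_convex {K : Set E} (hK : Convex ℝ K) (hKM : K ⊆ M) {x y : M}
    {γ γ' : Path x y} (hγ : ∀ t, (γ t : E) ∈ K) (hγ' : ∀ t, (γ' t : E) ∈ K) :
    γ.Homotopic γ' := by
  have hmem (p : I × I) : (1 - (p.1 : ℝ)) • (γ p.2 : E) + (p.1 : ℝ) • (γ' p.2 : E) ∈ K :=
    hK (hγ _) (hγ' _) (by linarith [p.1.2.2]) p.1.2.1 (by ring)
  refine ⟨⟨⟨⟨fun p => ⟨_, hKM (hmem p)⟩, ?_⟩, fun t => ?_, fun t => ?_⟩, ?_⟩⟩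
  · refine Continuous.subtype_mk ?_ _
    have h1 : Continuous fun p : I × I => (γ p.2 : E) :=
      continuous_subtype_val.comp (γ.continuous.comp continuous_snd)
    have h2 : Continuous fun p : I × I => (γ' p.2 : E) :=
      continuous_subtype_val.comp (γ'.continuous.comp continuous_snd)
    fun_prop
  · ext; simp
  · ext; simp
  · rintro t s (rfl | rfl) <;> ext <;> simp [← add_smul]

theorem exists_path_segment {x y : M} (h : segment ℝ (x : E) y ⊆ M) :
    ∃ γ : Path x y, ∀ t, (γ t : E) ∈ segment ℝ (x : E) y := by
  have hmem (t : I) : (1 - (t : ℝ)) • (x : E) + (t : ℝ) • (y : E) ∈ segment ℝ (x : E) y :=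
    ⟨_, _, by linarith [t.2.2], t.2.1, by ring, rfl⟩
  exact ⟨⟨⟨fun t => ⟨_, h (hmem t)⟩, Continuous.subtype_mk (by fun_prop) _⟩,
    by ext; simp, by ext; simp⟩, hmem⟩

/-- On an open subset of a normed space, every additive function on path classes is the integral
of a local cocycle. -/
theorem IsAdditiveOnPaths.exists_cocycle (hM : IsOpen M) {ψ : ∀ {x y : M}, Path x y → A}
    (hψ : IsAdditiveOnPaths @ψ) :
    ∃ c : E → E → A, IsLocalCocycle c M ∧ ∀ {x y : M} (γ : Path x y),
      cocycleIntegral (fun x y : M => c x y) γ = ψ γ := by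
  classical
  let c : E → E → A := fun x y =>
    if h : ∃ (hx : x ∈ M) (hy : y ∈ M), segment ℝ x y ⊆ M then
      ψ (exists_path_segment (x := ⟨x, h.1⟩) (y := ⟨y, h.2.1⟩) h.2.2).choose else 0
  have hc {K : Set E} (hK : Convex ℝ K) (hKM : K ⊆ M) {x y : M} (γ : Path x y)
      (hγ : ∀ t, (γ t : E) ∈ K) : c x y = ψ γ := by
    have hx : (x : E) ∈ K := by simpa using hγ 0
    have hy : (y : E) ∈ K := by simpa using hγ 1
    have hs := hK.segment_subset hx hy
    have h : ∃ (hx : (x : E) ∈ M) (hy : (y : E) ∈ M), segment ℝ (x : E) y ⊆ M :=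
      ⟨x.2, y.2, hs.trans hKM⟩
    simp only [c]
    rw [dif_pos h]
    refine hψ.1 (Path.homotopic_of_convex hK hKM (fun t => hs ?_) hγ)
    exact (exists_path_segment (x := (⟨x, h.1⟩ : M)) (y := ⟨y, h.2.1⟩) h.2.2).choose_spec t
  refine ⟨c, ?_, ?_⟩
  · intro p hp
    obtain ⟨r, hr, hB⟩ := Metric.isOpen_iff.1 hM p hp
    refine ⟨Metric.ball p r, Metric.ball_mem_nhds p hr, fun x => c p x, fun x hx y hy => ?_⟩
    have hK := convex_ball p r
    have hpB := Metric.mem_ball_self (x := p) hr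
    obtain ⟨γ, hγ⟩ := exists_path_segment (x := ⟨p, hp⟩) (y := ⟨x, hB hx⟩)
      ((hK.segment_subset hpB hx).trans hB)
    obtain ⟨γ', hγ'⟩ := exists_path_segment (x := ⟨x, hB hx⟩) (y := ⟨y, hB hy⟩)
      ((hK.segment_subset hx hy).trans hB)
    have h1 := hc hK hB γ fun t => hK.segment_subset hpB hx (hγ t)
    have h2 := hc hK hB γ' fun t => hK.segment_subset hx hy (hγ' t)
    have h3 := hc hK hB (γ.trans γ') fun t => by
      rw [Path.trans_apply]
      split_ifs
      · exact hK.segment_subset hpB hx (hγ _)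
      · exact hK.segment_subset hx hy (hγ' _)
    simp only at h1 h2 h3
    simp only [h1, h2, h3, hψ.2]
    abel
  · intro x y γ
    have hv : IsPotential (fun s t => c (γ s) (γ t)) (fun t => ψ (γ.subpath 0 t)) Set.univ := by
      intro t _
      obtain ⟨r, hr, hB⟩ := Metric.isOpen_iff.1 hM _ (γ t).2
      have hcont : Continuous fun t => (γ t : E) := continuous_subtype_val.comp γ.continuous
      obtain ⟨ε, hε, hI⟩ := Metric.mem_nhds_iff.1
        (hcont.continuousAt.preimage_mem_nhds (Metric.ball_mem_nhds (γ t : E) hr))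
      refine ⟨_, Metric.ball_mem_nhds t hε, fun s hs s' hs' => ?_⟩
      beta_reduce
      rw [eq_sub_iff_add_eq', hc (convex_ball (γ t : E) r) hB (γ.subpath s s') ?_, ← hψ.2]
      · exact hψ.1 ⟨Path.Homotopy.subpathTransSubpath γ 0 s s'⟩
      · intro a
        have : γ.subpath s s' a ∈ Set.range (γ.subpath s s') := ⟨a, rfl⟩
        rw [Path.range_subpath] at this
        obtain ⟨b, hb, e⟩ := this
        rw [← e]
        refine hI ?_
        have hoc : Set.OrdConnected (Metric.ball t ε) := by
          refine ⟨fun a ha b hb z hz => ?_⟩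
          simp only [Metric.mem_ball, Subtype.dist_eq, Real.dist_eq, abs_lt] at ha hb ⊢
          have h1 : (a : ℝ) ≤ z := hz.1
          have h2 : (z : ℝ) ≤ b := hz.2
          constructor <;> linarith [ha.1, ha.2, hb.1, hb.2]
        exact hoc.uIcc_subset hs hs' hb
    rw [cocycleIntegral_eq (c := fun x y : M => c x y) hv]
    have h0 : ψ (γ.subpath 0 0) = 0 := by
      have := hψ.2 (γ.subpath 0 0) (γ.subpath 0 0)
      rw [hψ.1 ⟨Path.Homotopy.subpathTransSubpath γ 0 0 0⟩] at this
      simpa using this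
    have h1 : ψ (γ.subpath 0 1) = ψ γ := by
      rw [Path.subpath_zero_one]
      have key : ∀ {x' y' : M} (hx : x' = x) (hy : y' = y), ψ (γ.cast hx hy) = ψ γ := by
        rintro _ _ rfl rfl
        rfl
      exact key _ _
    rw [h0, h1, sub_zero]

end Segments

section Winding

open Complex

/-- The integer `n` such that `s - log (exp s) = 2πi n`. -/
def branchIndex (s : ℂ) : ℤ :=
  (exp_eq_exp_iff_exists_int.1 (exp_log (exp_ne_zero s)).symm).choose

theorem branchIndex_spec (s : ℂ) : s = log (exp s) + branchIndex s * (2 * Real.pi * Complex.I) :=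
  (exp_eq_exp_iff_exists_int.1 (exp_log (exp_ne_zero s)).symm).choose_spec

theorem branchIndex_add_two_pi_I (s : ℂ) :
    branchIndex (s + 2 * Real.pi * Complex.I) = branchIndex s + 1 := by
  have h1 := branchIndex_spec s
  have h2 := branchIndex_spec (s + 2 * Real.pi * Complex.I)
  rw [exp_periodic s] at h2
  have h : ((branchIndex (s + 2 * Real.pi * Complex.I) : ℂ) - (branchIndex s + 1)) *
      (2 * Real.pi * Complex.I) = 0 := by linear_combination h1 - h2
  have := (mul_eq_zero.1 h).resolve_right two_pi_I_ne_zero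
  exact_mod_cast sub_eq_zero.1 this

/-- The cocycle on `ℂ ∖ {0}` whose integral along a loop is its winding number around `0`. -/
def windingCocycle (x y : ℂ) : ℤ :=
  branchIndex (log (y / x) + log x)

theorem windingCocycle_eq {x y : ℂ} (hx : x ≠ 0) (hy : y ≠ 0) :
    log (y / x) + log x = log y + windingCocycle x y * (2 * Real.pi * Complex.I) := by
  have := branchIndex_spec (log (y / x) + log x)
  rwa [exp_add, exp_log (div_ne_zero hy hx), exp_log hx, div_mul_cancel₀ _ hx] at this

theorem isPotential_windingCocycle_exp :
    IsPotential (fun a b => windingCocycle (exp a) (exp b)) branchIndex Set.univ := by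
  intro p _
  refine ⟨Metric.ball p (Real.pi / 2), Metric.ball_mem_nhds p (by positivity),
    fun x hx y hy => ?_⟩
  have h := windingCocycle_eq (exp_ne_zero x) (exp_ne_zero y)
  have hd : ‖y - x‖ < Real.pi := by
    rw [← dist_eq_norm]
    linarith [dist_triangle_right y x p, Metric.mem_ball.1 hx, Metric.mem_ball.1 hy]
  have him := abs_lt.1 ((abs_im_le_norm (y - x)).trans_lt hd)
  rw [← exp_sub, log_exp him.1 him.2.le] at h
  have h1 := branchIndex_spec x
  have h2 := branchIndex_spec y
  have e : ((windingCocycle (exp x) (exp y) : ℂ) - (branchIndex y - branchIndex x)) *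
      (2 * Real.pi * Complex.I) = 0 := by linear_combination h2 - h1 - h
  have := (mul_eq_zero.1 e).resolve_right two_pi_I_ne_zero
  exact_mod_cast sub_eq_zero.1 this

theorem exists_log_branch {p : ℂ} (hp : p ≠ 0) :
    ∃ s : ℂ → ℂ, ContinuousAt s p ∧ ∀ z, z ≠ 0 → exp (s z) = z := by
  refine ⟨fun z => log (z / p) + log p, ?_, fun z hz => ?_⟩
  · refine ContinuousAt.add (ContinuousAt.clog ?_ ?_) continuousAt_const
    · exact continuousAt_id.div_const p
    · simp [hp]
  · rw [exp_add, exp_log (div_ne_zero hz hp), exp_log hp, div_mul_cancel₀ _ hp]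

theorem isLocalCocycle_windingCocycle : IsLocalCocycle windingCocycle {z | z ≠ 0} := by
  intro p hp
  obtain ⟨s, hs, he⟩ := exists_log_branch hp
  obtain ⟨W, hW, hu⟩ := isPotential_windingCocycle_exp (s p) trivial
  refine ⟨_, Filter.inter_mem (hs hW) (isOpen_ne.mem_nhds hp), fun z => branchIndex (s z), ?_⟩
  rintro x ⟨hx, hx0⟩ y ⟨hy, hy0⟩
  have := hu _ hx _ hy
  beta_reduce at this
  rwa [he x hx0, he y hy0] at this

theorem cocycleIntegral_windingCocycle {γ : I → ℂ} {s : I → ℂ} (hs : Continuous s)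
    (h : ∀ t, exp (s t) = γ t) :
    cocycleIntegral windingCocycle γ = branchIndex (s 1) - branchIndex (s 0) := by
  refine cocycleIntegral_eq (v := fun t => branchIndex (s t)) ?_
  have := isPotential_windingCocycle_exp.comp_continuous hs
  simp only [h] at this
  exact this

theorem cocycleIntegral_windingCocycle_circle {r : ℂ} (hr : r ≠ 0) :
    cocycleIntegral windingCocycle (fun t : I => r * exp (t * (2 * Real.pi * Complex.I))) = 1 := by
  rw [cocycleIntegral_windingCocycle (s := fun t => log r + t * (2 * Real.pi * Complex.I))]
  · have := branchIndex_add_two_pi_I (log r)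
    simp [this]
  · fun_prop
  · intro t
    rw [exp_add, exp_log hr]

end Winding

section Fill

/-- A local cocycle defined off a thin set `D` which has primitives on punctured neighbourhoods of
the points of `D` extends over `D` up to a coboundary. -/
theorem exists_isLocalCocycle_extension {X A : Type*} [TopologicalSpace X] [AddCommGroup A]
    {U D : Set X} {c : X → X → A} (hD : IsClosed D) (hDd : Dense Dᶜ) {W : X → Set X}
    {u : X → X → A} (hWo : ∀ p ∈ U, IsOpen (W p)) (hWp : ∀ p ∈ U, p ∈ W p)
    (hWU : ∀ p ∈ U, W p ⊆ U)
    (hu : ∀ p ∈ U, IsPotential c (u p) (W p \ D))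
    (hW : ∀ p ∈ U, ∀ q ∈ U, IsPreconnected ((W p ∩ W q) \ D)) :
    ∃ (c' : X → X → A) (g : X → A), IsLocalCocycle c' U ∧
      IsPotential (fun x y => c x y - c' x y) g (U \ D) := by
  classical
  have hconst {p q : X} (hp : p ∈ U) (hq : q ∈ U) {x y : X} (hx : x ∈ (W p ∩ W q) \ D)
      (hy : y ∈ (W p ∩ W q) \ D) : u p x - u q x = u p y - u q y :=
    ((hu p hp).mono (Set.sdiff_subset_sdiff_left Set.inter_subset_left)).sub_eq_sub
      ((hu q hq).mono (Set.sdiff_subset_sdiff_left Set.inter_subset_right)) (hW p hp q hq) hx hy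
  have hne {O : Set X} (hO : IsOpen O) (h : O.Nonempty) : (O \ D).Nonempty :=
    hDd.inter_open_nonempty O hO h
  -- the extended primitive on `W p`
  have hv (p x : X) : ∃ a : A, p ∈ U → x ∈ W p → ∀ z ∈ (W p ∩ W x) \ D, u p z - u x z = a := by
    by_cases h : p ∈ U ∧ x ∈ W p
    · have hx := hWU p h.1 h.2
      obtain ⟨z, hz⟩ := hne ((hWo p h.1).inter (hWo x hx)) ⟨x, h.2, hWp x hx⟩
      exact ⟨u p z - u x z, fun hp hx' z' hz' => hconst h.1 hx hz' hz⟩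
    · exact ⟨0, fun h1 h2 => absurd ⟨h1, h2⟩ h⟩
  choose v hv using hv
  have hvv {p q x y : X} (hp : p ∈ U) (hq : q ∈ U) (hx : x ∈ W p ∩ W q) (hy : y ∈ W p ∩ W q) :
      v p y - v p x = v q y - v q x := by
    have key {x : X} (hx : x ∈ W p ∩ W q) :
        ∃ z ∈ (W p ∩ W q) \ D, v p x - v q x = u p z - u q z := by
      have hxU := hWU p hp hx.1
      obtain ⟨z, hz, hzD⟩ := hne (((hWo p hp).inter (hWo q hq)).inter (hWo x hxU))
        ⟨x, hx, hWp x hxU⟩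
      refine ⟨z, ⟨hz.1, hzD⟩, ?_⟩
      rw [← hv p x hp hx.1 z ⟨⟨hz.1.1, hz.2⟩, hzD⟩, ← hv q x hq hx.2 z ⟨⟨hz.1.2, hz.2⟩, hzD⟩]
      abel
    obtain ⟨z, hz, e⟩ := key hx
    obtain ⟨z', hz', e'⟩ := key hy
    have := e.trans ((hconst hp hq hz hz').trans e'.symm)
    rw [sub_eq_sub_iff_add_eq_add] at this ⊢
    rw [← this, add_comm]
  let c' : X → X → A := fun x y =>
    if h : ∃ p ∈ U, x ∈ W p ∧ y ∈ W p then v h.choose y - v h.choose x else 0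
  have hc' {p x y : X} (hp : p ∈ U) (hx : x ∈ W p) (hy : y ∈ W p) :
      c' x y = v p y - v p x := by
    have h : ∃ p ∈ U, x ∈ W p ∧ y ∈ W p := ⟨p, hp, hx, hy⟩
    simp only [c']
    rw [dif_pos h]
    have h' := h.choose_spec
    exact hvv h'.1 hp ⟨h'.2.1, hx⟩ ⟨h'.2.2, hy⟩
  refine ⟨c', fun x => u x x, fun p hp => ?_, fun p hp => ?_⟩
  · exact ⟨W p, (hWo p hp).mem_nhds (hWp p hp), v p, fun x hx y hy => hc' hp hx hy⟩
  · obtain ⟨O, hO, hu'⟩ := hu p hp.1 p ⟨hWp p hp.1, hp.2⟩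
    refine ⟨_, Filter.inter_mem hO (Filter.inter_mem ((hWo p hp.1).mem_nhds (hWp p hp.1))
      (hD.isOpen_compl.mem_nhds hp.2)), ?_⟩
    rintro x ⟨hx, hxW, hxD⟩ y ⟨hy, hyW, hyD⟩
    beta_reduce
    rw [hu' x hx y hy, hc' hp.1 hxW hyW,
      ← hv p x hp.1 hxW x ⟨⟨hxW, hWp x (hWU p hp.1 hxW)⟩, hxD⟩,
      ← hv p y hp.1 hyW y ⟨⟨hyW, hWp y (hWU p hp.1 hyW)⟩, hyD⟩]
    abel

/-- Every local cocycle on a convex open set has a primitive. -/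
theorem IsLocalCocycle.exists_isPotential_of_convex {E A : Type*} [NormedAddCommGroup E]
    [NormedSpace ℝ E] [AddCommGroup A] {K : Set E} {c : E → E → A} (hK : Convex ℝ K)
    (hKo : IsOpen K) (hc : IsLocalCocycle c K) : ∃ u, IsPotential c u K := by
  classical
  rcases K.eq_empty_or_nonempty with rfl | hne
  · exact ⟨0, fun _ h => h.elim⟩
  have := hK.contractibleSpace hne
  have := hKo.locallyPathConnectedSpace
  obtain ⟨v, hv⟩ := (hc.comp (f := (Subtype.val : K → E)) (T := Set.univ)
    (fun _ _ => continuous_subtype_val.continuousAt) (fun x _ => x.2)).exists_isPotential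
  refine ⟨fun x => if h : x ∈ K then v ⟨x, h⟩ else 0, fun p hp => ?_⟩
  obtain ⟨W, hW, hu⟩ := hv ⟨p, hp⟩ trivial
  refine ⟨Subtype.val '' W, hKo.isOpenMap_subtype_val.image_mem_nhds hW, ?_⟩
  rintro _ ⟨x, hx, rfl⟩ _ ⟨y, hy, rfl⟩
  simpa using hu x hx y hy

end Fill

section Hyperplane

open Complex

variable {E A : Type*} [NormedAddCommGroup E] [NormedSpace ℂ E] [AddCommGroup A]

theorem segment_apply_ne_zero (L : E →L[ℂ] ℂ) (b : ℂ) {x y : E} (hx : L x + b ≠ 0)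
    (h : (L y + b) / (L x + b) ∈ slitPlane) {z : E} (hz : z ∈ segment ℝ x y) : L z + b ≠ 0 := by
  obtain ⟨s, t, hs, ht, hst, rfl⟩ := hz
  have h1 : (s : ℂ) + t * ((L y + b) / (L x + b)) ∈ slitPlane := by
    have := starConvex_one_slitPlane h hs ht hst
    simpa using this
  have e : L (s • x + t • y) + b = (L x + b) * ((s : ℂ) + t * ((L y + b) / (L x + b))) := by
    have hst' : (s : ℂ) + t = 1 := by exact_mod_cast hst
    have e1 : L (s • x) = (s : ℂ) * L x := by
      rw [← Complex.coe_smul, map_smul, smul_eq_mul]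
    have e2 : L (t • y) = (t : ℂ) * L y := by
      rw [← Complex.coe_smul, map_smul, smul_eq_mul]
    rw [map_add, e1, e2]
    field_simp
    linear_combination (-b) * hst'
  rw [e]
  exact mul_ne_zero hx (slitPlane_ne_zero h1)

/-- A convex open set minus a complex hyperplane is connected. -/
theorem isPreconnected_convex_diff_hyperplane {L : E →L[ℂ] ℂ} (b : ℂ) {e : E} (he : L e = 1)
    {K : Set E} (hK : Convex ℝ K) (hKo : IsOpen K) :
    IsPreconnected (K \ {x | L x + b = 0}) := by
  refine isPreconnected_of_forall_pair fun x hx y hy => ?_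
  have hseg {x y : E} (hx : x ∈ K \ {x | L x + b = 0}) (hy : y ∈ K \ {x | L x + b = 0})
      (h : (L y + b) / (L x + b) ∈ slitPlane) : segment ℝ x y ⊆ K \ {x | L x + b = 0} :=
    fun z hz => ⟨hK.segment_subset hx.1 hy.1 hz, segment_apply_ne_zero L b hx.2 h hz⟩
  by_cases h : (L y + b) / (L x + b) ∈ slitPlane
  · exact ⟨_, hseg hx hy h, left_mem_segment ℝ x y, right_mem_segment ℝ x y,
      (convex_segment x y).isPreconnected⟩
  have hx0 : L x + b ≠ 0 := hx.2
  have hy0 : L y + b ≠ 0 := hy.2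
  have hcont : ContinuousAt (fun t : ℝ => x + ((t : ℂ) * Complex.I * (L x + b)) • e) 0 := by
    fun_prop
  have hmem : ∀ᶠ t : ℝ in 𝓝 0, x + ((t : ℂ) * Complex.I * (L x + b)) • e ∈ K :=
    hcont.eventually_mem (hKo.mem_nhds (by simpa using hx.1))
  obtain ⟨t, htK, ht0⟩ := ((hmem.filter_mono nhdsWithin_le_nhds).and
    (self_mem_nhdsWithin (a := (0 : ℝ)) (s := Set.Ioi 0))).exists
  have ht0 : 0 < t := ht0
  set z := x + ((t : ℂ) * Complex.I * (L x + b)) • e with hz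
  have hLz : L z + b = (L x + b) * (1 + t * Complex.I) := by
    rw [hz, map_add, map_smul, he, smul_eq_mul]; ring
  have ht1 : (1 + t * Complex.I : ℂ) ∈ slitPlane := by
    left; simp
  have ht1' := slitPlane_ne_zero ht1
  have hz0 : L z + b ≠ 0 := by
    rw [hLz]; exact mul_ne_zero hx0 ht1'
  have h1 : (L z + b) / (L x + b) ∈ slitPlane := by
    rw [hLz, mul_div_cancel_left₀ _ hx0]; exact ht1
  have h2 : (L y + b) / (L z + b) ∈ slitPlane := by
    set r := (L y + b) / (L x + b) with hr
    have hr0 : r ≠ 0 := div_ne_zero hy0 hx0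
    have e : (L y + b) / (L z + b) = r / (1 + t * Complex.I) := by
      rw [hLz, hr, div_div]
    rw [e]
    rw [mem_slitPlane_iff, not_or, not_lt, not_not] at h
    right
    have hrre : r.re ≠ 0 := fun h0 => hr0 (Complex.ext h0 h.2)
    rw [Complex.div_im]
    simp [h.2, hrre, ht0.ne', ht1']
  refine ⟨segment ℝ x z ∪ segment ℝ z y, ?_, Or.inl (left_mem_segment ℝ x z),
    Or.inr (right_mem_segment ℝ z y), ?_⟩
  · exact Set.union_subset (hseg hx ⟨htK, hz0⟩ h1) (hseg ⟨htK, hz0⟩ hy h2)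
  · exact (convex_segment x z).isPreconnected.union z (right_mem_segment ℝ x z)
      (left_mem_segment ℝ z y) (convex_segment z y).isPreconnected

/-- Near a point of the hyperplane, a local cocycle on the complement of the hyperplane is a
multiple of the winding cocycle up to a coboundary. -/
theorem exists_isPotential_near_hyperplane {L : E →L[ℂ] ℂ} {b : ℂ} {e : E} (he : L e = 1)
    {U : Set E} (hU : IsOpen U) {c : E → E → A} (hc : IsLocalCocycle c (U \ {x | L x + b = 0}))
    {p : E} (hp : p ∈ U) (hpD : L p + b = 0) :
    ∃ r > 0, Metric.ball p r ⊆ U ∧ ∃ (a : A) (u : E → A),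
      IsPotential (fun x y => c x y - windingCocycle (L x + b) (L y + b) • a) u
        (Metric.ball p r \ {x | L x + b = 0}) := by
  let Φ : E × ℂ → E := fun z => p + (z.1 - L z.1 • e) + z.2 • e
  have hΦ : Continuous Φ := by fun_prop
  have hΦ0 : Φ (0, 0) = p := by simp [Φ]
  have hLΦ (z : E × ℂ) : L (Φ z) + b = z.2 := by
    simp only [Φ, map_add, map_sub, map_smul, he, smul_eq_mul]
    linear_combination hpD
  have hΦs (x : E) : Φ (x - p, L x + b) = x := by
    have : L (x - p) = L x + b := by rw [map_sub]; linear_combination -hpD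
    simp only [Φ, this]
    abel
  obtain ⟨δ, hδ, hδU⟩ := Metric.mem_nhds_iff.1 (hΦ.continuousAt.preimage_mem_nhds
    (by rw [hΦ0]; exact hU.mem_nhds hp))
  let C : Set (E × ℂ) := Metric.ball 0 δ ×ˢ {s | s.re < Real.log δ}
  have hC : Convex ℝ C := (convex_ball _ _).prod (convex_halfSpace_re_lt _)
  have hCo : IsOpen C := Metric.isOpen_ball.prod (isOpen_lt Complex.continuous_re continuous_const)
  let Ψ : E × ℂ → E := fun z => Φ (z.1, exp z.2)
  have hΨ : Continuous Ψ := by fun_prop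
  have hexp {s : ℂ} : ‖exp s‖ < δ ↔ s.re < Real.log δ := by
    rw [Complex.norm_exp, Real.lt_log_iff_exp_lt hδ]
  have hΨC : Set.MapsTo Ψ C (U \ {x | L x + b = 0}) := by
    rintro ⟨y, s⟩ ⟨hy, hs⟩
    refine ⟨hδU ?_, ?_⟩
    · rw [← ball_prod_same]
      exact ⟨hy, by simpa using hexp.2 hs⟩
    · simp [Ψ, hLΦ, exp_ne_zero]
  obtain ⟨V, hV⟩ := (hc.comp (fun z _ => hΨ.continuousAt) hΨC).exists_isPotential_of_convex hC hCo
  let T : E × ℂ → E × ℂ := fun z => (z.1, z.2 + 2 * Real.pi * Complex.I)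
  have hT : Continuous T := by fun_prop
  have hTC : Set.MapsTo T C C := by
    rintro ⟨y, s⟩ ⟨hy, hs⟩
    refine ⟨hy, ?_⟩
    simpa [T] using hs
  have hΨT (z : E × ℂ) : Ψ (T z) = Ψ z := by
    simp only [Ψ, T, exp_periodic z.2]
  have hV' := hV.comp (fun z _ => hT.continuousAt) hTC
  simp only [hΨT] at hV'
  have h0C : ((0 : E), ((Real.log δ - 1 : ℝ) : ℂ)) ∈ C := ⟨by simpa using hδ, by simp⟩
  set a : A := V (T (0, ((Real.log δ - 1 : ℝ) : ℂ))) - V (0, ((Real.log δ - 1 : ℝ) : ℂ)) with ha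
  have hstep {z : E × ℂ} (hz : z ∈ C) : V (T z) = V z + a := by
    have := hV'.sub_eq_sub hV hC.isPreconnected hz h0C
    rw [← sub_eq_iff_eq_add']
    exact this
  have hperiod (n : ℕ) {y : E} {s : ℂ} (hz : (y, s) ∈ C) :
      V (y, s + n * (2 * Real.pi * Complex.I)) = V (y, s) + (n : ℤ) • a ∧
        (y, s + n * (2 * Real.pi * Complex.I)) ∈ C := by
    induction n with
    | zero => simpa using hz
    | succ n ih =>
      have e1 : (y, s + ((n + 1 : ℕ) : ℂ) * (2 * Real.pi * Complex.I)) =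
          T (y, s + n * (2 * Real.pi * Complex.I)) := by
        simp only [T, Prod.mk.injEq, true_and]; push_cast; ring
      rw [e1]
      refine ⟨?_, hTC ih.2⟩
      rw [hstep ih.2, ih.1]
      push_cast
      rw [add_smul, one_smul, add_assoc]
  have hperiodZ (n : ℤ) {y : E} {s : ℂ} (hz : (y, s) ∈ C) :
      V (y, s + n * (2 * Real.pi * Complex.I)) = V (y, s) + n • a := by
    obtain ⟨m, rfl | rfl⟩ := n.eq_nat_or_neg
    · exact_mod_cast (hperiod m hz).1
    · have hz' : (y, s + ((-(m : ℤ) : ℤ) : ℂ) * (2 * Real.pi * Complex.I)) ∈ C := by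
        refine ⟨hz.1, ?_⟩
        simpa using hz.2
      have := (hperiod m hz').1
      rw [show s + ((-(m : ℤ) : ℤ) : ℂ) * (2 * Real.pi * Complex.I) +
        m * (2 * Real.pi * Complex.I) = s by push_cast; ring] at this
      rw [this, neg_smul, add_neg_cancel_right]
  have hLc : Continuous fun x => L x + b := by fun_prop
  obtain ⟨r, hr, hrU⟩ := Metric.mem_nhds_iff.1 (Filter.inter_mem (hU.mem_nhds hp)
    (Filter.inter_mem (Metric.ball_mem_nhds p hδ) (hLc.continuousAt.preimage_mem_nhds
      (Metric.ball_mem_nhds (L p + b) hδ))))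
  refine ⟨r, hr, fun x hx => (hrU hx).1, a, fun x => V (x - p, log (L x + b)), ?_⟩
  rintro x₀ ⟨hx₀, hx₀D⟩
  obtain ⟨s, hs, hse⟩ := exists_log_branch hx₀D
  have hmem {x : E} (hx : x ∈ Metric.ball p r) (s : ℂ) (h : exp s = L x + b) :
      (x - p, s) ∈ C := by
    have h1 := (hrU hx).2
    refine ⟨by simpa [dist_eq_norm] using h1.1, hexp.1 ?_⟩
    have h2 := h1.2
    rw [hpD] at h2
    rw [h]
    simpa using h2
  have hτ : ContinuousAt (fun x => (x - p, s (L x + b))) x₀ :=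
    ContinuousAt.prodMk (by fun_prop) (ContinuousAt.comp (f := fun x => L x + b) hs hLc.continuousAt)
  obtain ⟨W, hW, hWV⟩ := hV (x₀ - p, s (L x₀ + b)) (hmem hx₀ _ (hse _ hx₀D))
  obtain ⟨W', hW', hWB⟩ := isPotential_windingCocycle_exp (s (L x₀ + b)) trivial
  refine ⟨_, Filter.inter_mem (hτ hW) (Filter.inter_mem
    ((ContinuousAt.comp (f := fun x => L x + b) hs hLc.continuousAt) hW') (Filter.inter_mem
      (Metric.isOpen_ball.mem_nhds hx₀) ((isOpen_ne.preimage hLc).mem_nhds hx₀D))), ?_⟩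
  have key {x : E} (hx : x ∈ Metric.ball p r) (hx0 : L x + b ≠ 0) :
      V (x - p, s (L x + b)) = V (x - p, log (L x + b)) + branchIndex (s (L x + b)) • a := by
    conv_lhs => rw [branchIndex_spec (s (L x + b)), hse _ hx0]
    exact hperiodZ _ (hmem hx _ (exp_log hx0))
  rintro x ⟨hx, hx', hxr, hx0⟩ y ⟨hy, hy', hyr, hy0⟩
  have h1 := hWV _ hx _ hy
  have h2 := hWB _ hx' _ hy'
  simp only [Ψ, Function.comp_apply, hse _ hx0, hse _ hy0, hΦs] at h1 h2
  beta_reduce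
  rw [h1, h2, key hxr hx0, key hyr hy0, sub_smul]
  abel

end Hyperplane

section Arrangement

open Complex

variable {E A : Type*} [NormedAddCommGroup E] [NormedSpace ℂ E] [AddCommGroup A]

/-- The circle of radius `ρ` around `p` in the complex line spanned by `e`. -/
def meridian (p e : E) (ρ : ℝ) (t : I) : E :=
  p + ((ρ : ℂ) * exp (t * (2 * Real.pi * Complex.I))) • e

theorem continuous_meridian (p e : E) (ρ : ℝ) : Continuous (meridian p e ρ) := by
  unfold meridian; fun_prop

theorem meridian_zero (p e : E) (ρ : ℝ) : meridian p e ρ 0 = p + (ρ : ℂ) • e := by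
  simp [meridian]

theorem meridian_one (p e : E) (ρ : ℝ) : meridian p e ρ 1 = p + (ρ : ℂ) • e := by
  simp [meridian]

theorem apply_meridian {L : E →L[ℂ] ℂ} {b : ℂ} {e p : E} (he : L e = 1) (hp : L p + b = 0)
    (ρ : ℝ) (t : I) :
    L (meridian p e ρ t) + b = ρ * exp (t * (2 * Real.pi * Complex.I)) := by
  rw [meridian, map_add, map_smul, he, smul_eq_mul]
  linear_combination hp

theorem norm_exp_two_pi (t : I) : ‖exp (t * (2 * Real.pi * Complex.I))‖ = 1 := by
  have := Complex.norm_exp_ofReal_mul_I ((t : ℝ) * (2 * Real.pi))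
  push_cast at this
  rwa [mul_assoc] at this

theorem exists_meridian_mem (p e : E) {W : Set E} (hW : W ∈ 𝓝 p) :
    ∃ ρ : ℝ, 0 < ρ ∧ ∀ t, meridian p e ρ t ∈ W := by
  have hc : ContinuousAt (fun z : ℂ => p + z • e) 0 := by fun_prop
  obtain ⟨δ, hδ, hδW⟩ := Metric.mem_nhds_iff.1 (hc.preimage_mem_nhds (by simpa using hW))
  refine ⟨δ / 2, by positivity, fun t => hδW ?_⟩
  rw [mem_ball_zero_iff, norm_mul, norm_exp_two_pi, mul_one, Complex.norm_real, Real.norm_eq_abs,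
    abs_of_pos (by positivity)]
  linarith

theorem cocycleIntegral_meridian {L : E →L[ℂ] ℂ} {b : ℂ} {e p : E} (he : L e = 1)
    (hp : L p + b = 0) {ρ : ℝ} (hρ : 0 < ρ) :
    cocycleIntegral (fun x y => windingCocycle (L x + b) (L y + b)) (meridian p e ρ) = 1 := by
  have := cocycleIntegral_windingCocycle_circle (r := ρ) (by exact_mod_cast hρ.ne')
  simp only [← apply_meridian he hp] at this
  exact this

theorem eq_zero_of_isPotential_winding {L : E →L[ℂ] ℂ} {b : ℂ} {e p : E} (he : L e = 1)
    (hp : L p + b = 0) {W : Set E} (hW : W ∈ 𝓝 p) {a : A} {u : E → A}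
    (hu : IsPotential (fun x y => windingCocycle (L x + b) (L y + b) • a) u
      (W \ {x | L x + b = 0})) : a = 0 := by
  obtain ⟨ρ, hρ, hρW⟩ := exists_meridian_mem p e hW
  have hne (t : I) : L (meridian p e ρ t) + b ≠ 0 := by
    rw [apply_meridian he hp]
    exact mul_ne_zero (by exact_mod_cast hρ.ne') (exp_ne_zero _)
  have h1 := cocycleIntegral_eq (γ := meridian p e ρ)
    (c := fun x y => windingCocycle (L x + b) (L y + b) • a) (hu.comp (f := meridian p e ρ) (T := Set.univ)
    (fun _ _ => (continuous_meridian p e ρ).continuousAt) fun t _ => ⟨hρW t, hne t⟩)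
  obtain ⟨v, hv⟩ := (isLocalCocycle_windingCocycle.comp (f := fun t => L (meridian p e ρ t) + b)
    (T := Set.univ) (fun _ _ => by have := continuous_meridian p e ρ; fun_prop)
    fun t _ => hne t).exists_isPotential_unitInterval
  have h2 := cocycleIntegral_eq (γ := meridian p e ρ)
    (c := fun x y => windingCocycle (L x + b) (L y + b) • a) (hv.zsmul a)
  have h3 := cocycleIntegral_eq (γ := meridian p e ρ)
    (c := fun x y => windingCocycle (L x + b) (L y + b)) hv
  have h4 := cocycleIntegral_meridian he hp hρ
  rw [h4] at h3
  rw [← sub_smul, ← h3, one_smul] at h2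
  rw [← h2]
  refine h1.trans ?_
  simp [meridian_zero, meridian_one]

theorem joinedIn_of_countable_line {S : Set E} {p q : E}
    (h : {z : ℂ | p + z • (q - p) ∉ S}.Countable) (hp : p ∈ S) (hq : q ∈ S) : JoinedIn S p q := by
  have hc := h.isPathConnected_compl_of_one_lt_rank (by rw [Complex.rank_real_complex]; norm_num)
  have h01 := hc.joinedIn 0 (by simpa using hp) 1 (by simpa using hq)
  have := (h01.map (f := fun z : ℂ => p + z • (q - p)) (by fun_prop)).mono (V := S) ?_
  · simpa using this
  · rintro _ ⟨z, hz, rfl⟩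
    simpa using hz

theorem countable_line_zero (L : E →L[ℂ] ℂ) (b : ℂ) {p q : E} (hp : L p + b ≠ 0) :
    {z : ℂ | L (p + z • (q - p)) + b = 0}.Countable := by
  refine Set.Subsingleton.countable fun z hz w hw => ?_
  simp only [Set.mem_ofPred_eq, map_add, map_smul, smul_eq_mul] at hz hw
  have h : L (q - p) ≠ 0 := by
    intro h0
    rw [h0, mul_zero, add_zero] at hz
    exact hp hz
  have : (z - w) * L (q - p) = 0 := by linear_combination hz - hw
  exact sub_eq_zero.1 ((mul_eq_zero.1 this).resolve_right h)

variable {ι : Type*} (L : ι → E →L[ℂ] ℂ) (b : ι → ℂ)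

/-- The complement of a finite arrangement of affine hyperplanes. -/
def arrangementCompl (s : Finset ι) : Set E := {x | ∀ i ∈ s, L i x + b i ≠ 0}

theorem isOpen_arrangementCompl (s : Finset ι) : IsOpen (arrangementCompl L b s) := by
  have : arrangementCompl L b s = ⋂ i ∈ s, {x | L i x + b i ≠ 0} := by
    ext; simp [arrangementCompl]
  rw [this]
  exact isOpen_biInter_finset fun i _ => isOpen_ne.preimage (by fun_prop)

theorem countable_line_arrangementCompl (s : Finset ι) {p : E} (q : E)
    (hp : p ∈ arrangementCompl L b s) :
    {z : ℂ | p + z • (q - p) ∉ arrangementCompl L b s}.Countable := by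
  have : {z : ℂ | p + z • (q - p) ∉ arrangementCompl L b s} =
      ⋃ i ∈ s, {z : ℂ | L i (p + z • (q - p)) + b i = 0} := by
    ext; simp [arrangementCompl]
  rw [this]
  exact s.countable_toSet.biUnion fun i hi => countable_line_zero (L i) (b i) (hp i hi)

theorem isPathConnected_arrangementCompl (s : Finset ι) (hne : (arrangementCompl L b s).Nonempty) :
    IsPathConnected (arrangementCompl L b s) := by
  obtain ⟨p, hp⟩ := hne
  exact ⟨p, hp, fun {q} hq =>
    joinedIn_of_countable_line (countable_line_arrangementCompl L b s q hp) hp hq⟩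

theorem isPreconnected_arrangementCompl_inter (s : Finset ι) (K : E →L[ℂ] ℂ) (k : ℂ) :
    IsPreconnected (arrangementCompl L b s ∩ {x | K x + k = 0}) := by
  refine isPreconnected_of_forall_pair fun p hp q hq => ?_
  have hJ : JoinedIn (arrangementCompl L b s ∩ {x | K x + k = 0}) p q := by
    refine joinedIn_of_countable_line
      ((countable_line_arrangementCompl L b s q hp.1).mono fun z hz => ?_) hp hq
    intro h
    refine hz ⟨h, ?_⟩
    have h1 : K p + k = 0 := hp.2
    have h2 : K q + k = 0 := hq.2
    change K (p + z • (q - p)) + k = 0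
    rw [map_add, map_smul, map_sub, smul_eq_mul]
    linear_combination (1 - z) * h1 + z * h2
  obtain ⟨γ, hγ⟩ := hJ
  exact ⟨Set.range γ, by rintro _ ⟨t, rfl⟩; exact hγ t, ⟨0, γ.source⟩, ⟨1, γ.target⟩,
    isPreconnected_range γ.continuous⟩

/-- Every local cocycle on the complement of a hyperplane in an arrangement complement is, up to a
multiple of the winding cocycle and a coboundary, the restriction of a local cocycle. -/
theorem exists_extension_over_hyperplane (s : Finset ι) {K : E →L[ℂ] ℂ} {k : ℂ} {e : E}
    (he : K e = 1) {c : E → E → A}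
    (hc : IsLocalCocycle c (arrangementCompl L b s \ {x | K x + k = 0})) :
    ∃ (a : A) (c' : E → E → A) (g : E → A), IsLocalCocycle c' (arrangementCompl L b s) ∧
      IsPotential (fun x y => c x y - windingCocycle (K x + k) (K y + k) • a - c' x y) g
        (arrangementCompl L b s \ {x | K x + k = 0}) := by
  set U := arrangementCompl L b s
  set D := {x | K x + k = 0}
  have hU : IsOpen U := isOpen_arrangementCompl L b s
  have hDc : IsClosed D := isClosed_eq (by fun_prop) continuous_const
  have hloc (p : E) (hp : p ∈ U ∩ D) : ∃ r > 0, Metric.ball p r ⊆ U ∧ ∃ (a : A) (u : E → A),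
      IsPotential (fun x y => c x y - windingCocycle (K x + k) (K y + k) • a) u
        (Metric.ball p r \ D) := exists_isPotential_near_hyperplane he hU hc hp.1 hp.2
  have hcompare {O O' : Set E} {p : E} (hpD : p ∈ D) {a a' : A} {u u' : E → A} (hO : O ∈ 𝓝 p)
      (hO' : O' ∈ 𝓝 p)
      (hu : IsPotential (fun x y => c x y - windingCocycle (K x + k) (K y + k) • a) u (O \ D))
      (hu' : IsPotential (fun x y => c x y - windingCocycle (K x + k) (K y + k) • a') u'
        (O' \ D)) : a = a' := by
    have h := (hu'.mono (Set.sdiff_subset_sdiff_left (Set.inter_subset_right (s := O)))).sub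
      (hu.mono (Set.sdiff_subset_sdiff_left (Set.inter_subset_left (t := O'))))
    have e (x y : E) : c x y - windingCocycle (K x + k) (K y + k) • a' -
        (c x y - windingCocycle (K x + k) (K y + k) • a) =
        windingCocycle (K x + k) (K y + k) • (a - a') := by
      rw [smul_sub]; abel
    simp only [e] at h
    exact sub_eq_zero.1 (eq_zero_of_isPotential_winding he hpD (Filter.inter_mem hO hO') h)
  obtain ⟨a, ha⟩ : ∃ a : A, ∀ p ∈ U ∩ D, ∃ r > 0, Metric.ball p r ⊆ U ∧ ∃ u : E → A,
      IsPotential (fun x y => c x y - windingCocycle (K x + k) (K y + k) • a) u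
        (Metric.ball p r \ D) := by
    rcases (U ∩ D).eq_empty_or_nonempty with h | ⟨p₀, hp₀⟩
    · exact ⟨0, by simp [h]⟩
    have hloc' (p : E) : ∃ a : A, p ∈ U ∩ D → ∃ r > 0, Metric.ball p r ⊆ U ∧ ∃ u : E → A,
        IsPotential (fun x y => c x y - windingCocycle (K x + k) (K y + k) • a) u
          (Metric.ball p r \ D) := by
      by_cases hp : p ∈ U ∩ D
      · obtain ⟨r, hr, hrU, a, u, hu⟩ := hloc p hp
        exact ⟨a, fun _ => ⟨r, hr, hrU, u, hu⟩⟩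
      · exact ⟨0, fun h => absurd h hp⟩
    choose τ hτ using hloc'
    let : TopologicalSpace A := ⊥
    have : DiscreteTopology A := ⟨rfl⟩
    have hcont : ContinuousOn τ (U ∩ D) := by
      intro p hp
      obtain ⟨r, hr, hrU, u, hu⟩ := hτ p hp
      refine (continuousWithinAt_const (b := τ p)).congr_of_eventuallyEq ?_ rfl
      filter_upwards [inter_mem_nhdsWithin (U ∩ D) (Metric.ball_mem_nhds p hr)]
        with q hq
      obtain ⟨r', hr', -, u', hu'⟩ := hτ q hq.1
      exact hcompare hq.1.2 (Metric.ball_mem_nhds q hr') (Metric.isOpen_ball.mem_nhds hq.2) hu' hu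
    refine ⟨τ p₀, fun p hp => ?_⟩
    rw [(isPreconnected_arrangementCompl_inter L b s K k).constant hcont hp₀ hp]
    exact hτ p hp
  have hw : IsLocalCocycle (fun x y => windingCocycle (K x + k) (K y + k)) (U \ D) :=
    isLocalCocycle_windingCocycle.comp (fun _ _ => by fun_prop) fun x hx => hx.2
  have hall (p : E) : ∃ (r : ℝ) (u : E → A), p ∈ U → 0 < r ∧ Metric.ball p r ⊆ U ∧
      IsPotential (fun x y => c x y - windingCocycle (K x + k) (K y + k) • a) u
        (Metric.ball p r \ D) := by
    by_cases hp : p ∈ U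
    · by_cases hpD : p ∈ D
      · obtain ⟨r, hr, hrU, u, hu⟩ := ha p ⟨hp, hpD⟩
        exact ⟨r, u, fun _ => ⟨hr, hrU, hu⟩⟩
      · obtain ⟨r, hr, hrU⟩ := Metric.isOpen_iff.1 (hU.sdiff hDc) p ⟨hp, hpD⟩
        obtain ⟨u, hu⟩ := ((hc.sub (hw.zsmul a)).mono hrU).exists_isPotential_of_convex
          (convex_ball p r) Metric.isOpen_ball
        exact ⟨r, u, fun _ => ⟨hr, fun x hx => (hrU hx).1, hu.mono Set.sdiff_subset⟩⟩
    · exact ⟨0, 0, fun h => absurd h hp⟩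
  choose r u hru using hall
  have hDd : Dense Dᶜ := by
    intro p
    rw [mem_closure_iff_nhds]
    intro O hO
    by_cases hpD : p ∈ D
    · obtain ⟨ρ, hρ, hρO⟩ := exists_meridian_mem p e hO
      refine ⟨meridian p e ρ 0, hρO 0, ?_⟩
      change ¬ (K _ + k = 0)
      rw [apply_meridian he hpD]
      exact mul_ne_zero (by exact_mod_cast hρ.ne') (exp_ne_zero _)
    · exact ⟨p, mem_of_mem_nhds hO, hpD⟩
  obtain ⟨c', g, hc', hg⟩ := exists_isLocalCocycle_extension (W := fun p => Metric.ball p (r p))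
    hDc hDd (fun _ _ => Metric.isOpen_ball) (fun p hp => Metric.mem_ball_self (hru p hp).1)
    (fun p hp => (hru p hp).2.1) (fun p hp => (hru p hp).2.2) fun p _ q _ =>
      isPreconnected_convex_diff_hyperplane k he ((convex_ball p _).inter (convex_ball q _))
        (Metric.isOpen_ball.inter Metric.isOpen_ball)
  exact ⟨a, c', g, hc', hg⟩

/-- On the complement of an arrangement of hyperplanes, every local cocycle is a combination of
winding cocycles up to a coboundary. -/
theorem IsLocalCocycle.exists_isPotential_sub_winding (s : Finset ι) (hL : ∀ i ∈ s, L i ≠ 0)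
    {c : E → E → A} (hc : IsLocalCocycle c (arrangementCompl L b s)) :
    ∃ (a : ι → A) (u : E → A), IsPotential
      (fun x y => c x y - ∑ i ∈ s, windingCocycle (L i x + b i) (L i y + b i) • a i) u
      (arrangementCompl L b s) := by
  classical
  induction s using Finset.induction_on generalizing c with
  | empty =>
    have : arrangementCompl L b ∅ = Set.univ := by ext; simp [arrangementCompl]
    rw [this] at hc ⊢
    obtain ⟨u, hu⟩ := hc.exists_isPotential_of_convex convex_univ isOpen_univ
    exact ⟨0, u, by simpa using hu⟩
  | insert i s hi ih =>
    have hM : arrangementCompl L b (insert i s) =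
        arrangementCompl L b s \ {x | L i x + b i = 0} := by
      ext; simp [arrangementCompl, and_comm]
    obtain ⟨e, he⟩ : ∃ e, L i e = 1 := by
      obtain ⟨e, he⟩ : ∃ e, L i e ≠ 0 := by
        by_contra! h
        exact hL i (Finset.mem_insert_self i s) (ContinuousLinearMap.ext h)
      exact ⟨(L i e)⁻¹ • e, by simp [he]⟩
    rw [hM] at hc ⊢
    obtain ⟨a₀, c', g, hc', hg⟩ := exists_extension_over_hyperplane L b s he hc
    obtain ⟨a, u, hu⟩ := ih (fun j hj => hL j (Finset.mem_insert_of_mem hj)) hc'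
    refine ⟨Function.update a i a₀, fun x => g x + u x, ?_⟩
    have := hg.add (hu.mono Set.sdiff_subset)
    have e (x y : E) : c x y - ∑ j ∈ insert i s,
        windingCocycle (L j x + b j) (L j y + b j) • Function.update a i a₀ j =
        c x y - windingCocycle (L i x + b i) (L i y + b i) • a₀ - c' x y +
          (c' x y - ∑ j ∈ s, windingCocycle (L j x + b j) (L j y + b j) • a j) := by
      rw [Finset.sum_insert hi, Function.update_self, Finset.sum_congr rfl fun j hj => by
        rw [Function.update_of_ne (ne_of_mem_of_not_mem hj hi)]]
      abel
    simp only [e]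
    exact this

end Arrangement

section ArrangementGroup

variable {E : Type*} [NormedAddCommGroup E] [NormedSpace ℂ E] {ι : Type*} [Fintype ι]
  (L : ι → E →L[ℂ] ℂ) (b : ι → ℂ)

theorem isLocalCocycle_arrangementCompl (i : ι) :
    IsLocalCocycle (fun x y : arrangementCompl L b Finset.univ =>
      windingCocycle (L i x + b i) (L i y + b i)) Set.univ :=
  isLocalCocycle_windingCocycle.comp (f := fun x : arrangementCompl L b Finset.univ =>
    L i x + b i) (fun _ _ => by fun_prop) fun x _ => x.2 i (Finset.mem_univ i)

/-- The winding numbers of a loop around all hyperplanes of an arrangement. -/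
def windingHom (z : arrangementCompl L b Finset.univ) :
    FundamentalGroup (arrangementCompl L b Finset.univ) z →* (ι → Multiplicative ℤ) :=
  MonoidHom.pi fun i => (isLocalCocycle_arrangementCompl L b i).integralHom z

theorem ker_windingHom_le (hL : ∀ i, L i ≠ 0) (z : arrangementCompl L b Finset.univ) :
    (windingHom L b z).ker ≤ commutator _ := by
  let M : Set E := arrangementCompl L b Finset.univ
  have hMo : IsOpen M := isOpen_arrangementCompl L b _
  have : PathConnectedSpace M := isPathConnected_iff_pathConnectedSpace.1
    (isPathConnected_arrangementCompl L b _ ⟨z, z.2⟩)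
  let φ : FundamentalGroup M z →* Multiplicative (Additive (Abelianization (FundamentalGroup M z))) :=
    Abelianization.of
  obtain ⟨ψ, hψ, hφ⟩ := exists_isAdditiveOnPaths φ
  obtain ⟨c, hc, hcψ⟩ := hψ.exists_cocycle hMo
  obtain ⟨a, u, hu⟩ := hc.exists_isPotential_sub_winding L b Finset.univ fun i _ => hL i
  intro g hg
  obtain ⟨γ : Path z z, rfl⟩ := Path.Homotopic.Quotient.mk_surjective g
  have hw (i : ι) : cocycleIntegral (fun x y : M =>
      windingCocycle (L i x + b i) (L i y + b i)) γ = 0 :=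
    congrFun (MonoidHom.mem_ker.1 hg) i
  have hγ : Continuous fun t => (γ t : E) := continuous_subtype_val.comp γ.continuous
  have hzero : ψ γ = 0 := by
    have h1 := cocycleIntegral_zsmul_sum Finset.univ (a := a) (γ := γ)
      (fun i _ => isLocalCocycle_arrangementCompl L b i) γ.continuous
    rw [Finset.sum_eq_zero fun i _ => by rw [hw i, zero_smul]] at h1
    obtain ⟨v, hv⟩ := (hc.comp (f := fun t => (γ t : E)) (T := Set.univ)
      (fun _ _ => hγ.continuousAt) fun t _ => (γ t).2).exists_isPotential_unitInterval
    have hu' := hu.comp (f := fun t => (γ t : E)) (T := Set.univ)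
      (fun _ _ => hγ.continuousAt) fun t _ => (γ t).2
    have h2 := cocycleIntegral_eq (γ := γ) (c := fun x y : M => c x y) hv
    have h3 := hv.sub hu'
    simp only [sub_sub_cancel] at h3
    have h4 := cocycleIntegral_eq (γ := γ) (c := fun x y : M =>
      ∑ i, windingCocycle (L i x + b i) (L i y + b i) • a i) h3
    rw [h1] at h4
    simp only [Function.comp_apply, γ.source, γ.target] at h4
    rw [← hcψ, h2]
    rw [sub_sub_sub_cancel_right] at h4
    exact h4.symm
  have h := hφ γ
  rw [hzero] at h
  exact (QuotientGroup.eq_one_iff _).1 h.symm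

theorem exists_windingHom_eq_mulSingle [DecidableEq ι] (z : arrangementCompl L b Finset.univ)
    {i : ι} {e y : E} (he : L i e = 1) (hy : L i y + b i = 0)
    (hyj : ∀ j, j ≠ i → L j y + b j ≠ 0) :
    ∃ g, windingHom L b z g = Pi.mulSingle i (Multiplicative.ofAdd 1) := by
  let M : Set E := arrangementCompl L b Finset.univ
  have : PathConnectedSpace M := isPathConnected_iff_pathConnectedSpace.1
    (isPathConnected_arrangementCompl L b _ ⟨z, z.2⟩)
  obtain ⟨r, hr, hB⟩ := Metric.isOpen_iff.1 (isOpen_arrangementCompl L b (Finset.univ.erase i)) y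
    fun j hj => hyj j (Finset.ne_of_mem_erase hj)
  obtain ⟨ρ, hρ, hρB⟩ := exists_meridian_mem y e (Metric.ball_mem_nhds y hr)
  have hmem (t : I) : meridian y e ρ t ∈ M := by
    intro j _
    by_cases hj : j = i
    · subst hj
      rw [apply_meridian he hy]
      exact mul_ne_zero (by exact_mod_cast hρ.ne') (Complex.exp_ne_zero _)
    · exact hB (hρB t) j (Finset.mem_erase.2 ⟨hj, Finset.mem_univ j⟩)
  let q : M := ⟨meridian y e ρ 0, hmem 0⟩
  let m : Path q q :=
    ⟨⟨fun t => ⟨_, hmem t⟩, (continuous_meridian y e ρ).subtype_mk hmem⟩, rfl,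
      Subtype.ext ((meridian_one y e ρ).trans (meridian_zero y e ρ).symm)⟩
  let δ : Path z q := PathConnectedSpace.somePath z q
  refine ⟨FundamentalGroup.fromPath (.mk ((δ.trans m).trans δ.symm)), ?_⟩
  ext j
  have hcj := isLocalCocycle_arrangementCompl L b j
  have h1 : cocycleIntegral (fun x y : M => windingCocycle (L j x + b j) (L j y + b j))
      ((δ.trans m).trans δ.symm) =
      cocycleIntegral (fun x y : M => windingCocycle (L j x + b j) (L j y + b j)) m := by
    have h2 := hcj.cocycleIntegral_trans δ δ.symm
    rw [← hcj.cocycleIntegral_eq_of_homotopic ⟨Path.Homotopy.reflTransSymm δ⟩] at h2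
    have h3 := hcj.cocycleIntegral_const z
    change cocycleIntegral _ (Path.refl z) = 0 at h3
    rw [h3] at h2
    rw [hcj.cocycleIntegral_trans, hcj.cocycleIntegral_trans]
    linarith
  change Multiplicative.ofAdd (cocycleIntegral (fun x y : M =>
    windingCocycle (L j x + b j) (L j y + b j)) ((δ.trans m).trans δ.symm)) = _
  rw [h1]
  by_cases hj : j = i
  · subst hj
    rw [Pi.mulSingle_eq_same]
    exact congrArg _ (cocycleIntegral_meridian he hy hρ)
  · rw [Pi.mulSingle_eq_of_ne hj]
    have hw : IsLocalCocycle (fun x y => windingCocycle (L j x + b j) (L j y + b j))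
        (Metric.ball y r) :=
      isLocalCocycle_windingCocycle.comp (fun _ _ => by fun_prop) fun x hx =>
        hB hx j (Finset.mem_erase.2 ⟨hj, Finset.mem_univ j⟩)
    obtain ⟨u, hu⟩ := hw.exists_isPotential_of_convex (convex_ball y r) Metric.isOpen_ball
    have h2 := cocycleIntegral_eq (γ := m) (c := fun x y : M =>
      windingCocycle (L j x + b j) (L j y + b j)) (hu.comp (f := meridian y e ρ) (T := Set.univ)
        (fun _ _ => (continuous_meridian y e ρ).continuousAt) fun t _ => hρB t)
    rw [h2, Function.comp_apply, Function.comp_apply, meridian_one, meridian_zero, sub_self]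
    rfl

theorem windingHom_surjective (hL : ∀ i, L i ≠ 0)
    (hy : ∀ i, ∃ y, L i y + b i = 0 ∧ ∀ j, j ≠ i → L j y + b j ≠ 0)
    (z : arrangementCompl L b Finset.univ) : Function.Surjective (windingHom L b z) := by
  classical
  rw [← MonoidHom.range_eq_top, eq_top_iff]
  intro f _
  rw [← Finset.univ_prod_mulSingle f]
  refine Subgroup.prod_mem _ fun i _ => ?_
  obtain ⟨e, he⟩ : ∃ e, L i e ≠ 0 := by
    by_contra! h
    exact hL i (ContinuousLinearMap.ext h)
  obtain ⟨y, hyi, hyj⟩ := hy i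
  obtain ⟨g, hg⟩ := exists_windingHom_eq_mulSingle L b z (e := (L i e)⁻¹ • e) (by simp [he]) hyi hyj
  refine ⟨g ^ (Multiplicative.toAdd (f i)), ?_⟩
  rw [map_zpow, hg, ← Pi.mulSingle_zpow, ← ofAdd_zsmul, smul_eq_mul, mul_one, ofAdd_toAdd]

end ArrangementGroup

section PuncturedPlane

variable {A : Type*} [AddCommGroup A]

theorem IsLocalCocycle.exists_isPotential_coord_ne_zero {c : (Fin 2 → ℂ) → (Fin 2 → ℂ) → A}
    (hc : IsLocalCocycle c {0}ᶜ) {i j : Fin 2} (hij : i ≠ j) :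
    ∃ u, IsPotential c u {v | v i ≠ 0} := by
  let L : Fin 2 → (Fin 2 → ℂ) →L[ℂ] ℂ := fun i => ContinuousLinearMap.proj i
  have hM : arrangementCompl L 0 {i} = {v | v i ≠ 0} := by ext; simp [arrangementCompl, L]
  have hsub : {v : Fin 2 → ℂ | v i ≠ 0} ⊆ {0}ᶜ := by rintro v hv rfl; exact hv rfl
  have hL (l : Fin 2) : L l (Pi.single l 1) = 1 := by simp [L]
  obtain ⟨a, u, hu⟩ := IsLocalCocycle.exists_isPotential_sub_winding L 0 {i}
    (fun l _ h => by simpa [h] using hL l) (hM ▸ hc.mono hsub)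
  rw [hM] at hu
  simp only [Finset.sum_singleton] at hu
  have hp : (Pi.single j 1 : Fin 2 → ℂ) ∈ ({0}ᶜ : Set (Fin 2 → ℂ)) := by simp
  obtain ⟨W, hW, u', hu'⟩ := hc _ hp
  have h : IsPotential c u' (interior W) := fun p hp =>
    ⟨W, mem_interior_iff_mem_nhds.1 hp, hu'⟩
  have hd := (h.mono (Set.sdiff_subset (t := {x | L i x + 0 = 0}))).sub
    (hu.mono (V := interior W \ {x | L i x + 0 = 0}) fun v hv => by simpa [L] using hv.2)
  simp only [sub_sub_cancel] at hd
  have ha : a i = 0 := eq_zero_of_isPotential_winding (hL i) (by simp [L, hij])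
    (interior_mem_nhds.2 hW) hd
  simp only [ha, smul_zero, sub_zero] at hu
  exact ⟨u, hu⟩

/-- Every local cocycle on the punctured complex plane `ℂ² ∖ {0}` is a coboundary. -/
theorem IsLocalCocycle.exists_isPotential_compl_zero {c : (Fin 2 → ℂ) → (Fin 2 → ℂ) → A}
    (hc : IsLocalCocycle c {0}ᶜ) : ∃ u, IsPotential c u {0}ᶜ := by
  classical
  obtain ⟨u, hu⟩ := hc.exists_isPotential_coord_ne_zero (zero_ne_one : (0 : Fin 2) ≠ 1)
  obtain ⟨v, hv⟩ := hc.exists_isPotential_coord_ne_zero (one_ne_zero : (1 : Fin 2) ≠ 0)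
  let L : Fin 2 → (Fin 2 → ℂ) →L[ℂ] ℂ := fun i => ContinuousLinearMap.proj i
  have hM : arrangementCompl L 0 Finset.univ = {v | v 0 ≠ 0} ∩ {v | v 1 ≠ 0} := by
    ext; simp [arrangementCompl, L]
  have h1 : (fun _ => 1 : Fin 2 → ℂ) ∈ {v : Fin 2 → ℂ | v 0 ≠ 0} ∩ {v | v 1 ≠ 0} := by simp
  have hconn : IsPreconnected ({v : Fin 2 → ℂ | v 0 ≠ 0} ∩ {v | v 1 ≠ 0}) := hM ▸
    (isPathConnected_arrangementCompl L 0 Finset.univ ⟨_, hM ▸ h1⟩).isConnected.isPreconnected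
  have huv {p : Fin 2 → ℂ} (h0 : p 0 ≠ 0) (hp : p 1 ≠ 0) :
      v p + (u (fun _ => 1) - v fun _ => 1) = u p := by
    have := (hu.mono Set.inter_subset_left).sub_eq_sub (hv.mono Set.inter_subset_right) hconn
      ⟨h0, hp⟩ h1
    rw [← this]; abel
  refine ⟨fun p => if p 0 ≠ 0 then u p else v p + (u (fun _ => 1) - v fun _ => 1), ?_⟩
  intro p hp
  by_cases h0 : p 0 ≠ 0
  · obtain ⟨W, hW, hWu⟩ := hu p h0
    refine ⟨W ∩ {v | v 0 ≠ 0}, Filter.inter_mem hW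
      ((isOpen_ne.preimage (continuous_apply 0)).mem_nhds h0), fun x hx y hy => ?_⟩
    beta_reduce
    rw [if_pos (show x 0 ≠ 0 from hx.2), if_pos (show y 0 ≠ 0 from hy.2), hWu x hx.1 y hy.1]
  · have hp1 : p 1 ≠ 0 := fun h => hp (by ext i; fin_cases i <;> simp_all)
    obtain ⟨W, hW, hWv⟩ := hv p hp1
    have hglue {x : Fin 2 → ℂ} (hx : x 1 ≠ 0) :
        (if x 0 ≠ 0 then u x else v x + (u (fun _ => 1) - v fun _ => 1)) =
          v x + (u (fun _ => 1) - v fun _ => 1) := by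
      split_ifs with h
      · exact (huv h hx).symm
      · rfl
    refine ⟨W ∩ {v | v 1 ≠ 0}, Filter.inter_mem hW
      ((isOpen_ne.preimage (continuous_apply 1)).mem_nhds hp1), fun x hx y hy => ?_⟩
    beta_reduce
    rw [hglue hx.2, hglue hy.2, hWv x hx.1 y hy.1, add_sub_add_right_eq_sub]

theorem pathConnectedSpace_compl_zero : PathConnectedSpace ({0}ᶜ : Set (Fin 2 → ℂ)) :=
  isPathConnected_iff_pathConnectedSpace.1 <|
    (Set.countable_singleton 0).isPathConnected_compl_of_one_lt_rank <| by
      rw [← Module.finrank_eq_rank, Module.finrank_pi_fintype]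
      simp

/-- The fundamental group of the punctured complex plane is perfect. -/
theorem commutator_fundamentalGroup_compl_zero (z : ({0}ᶜ : Set (Fin 2 → ℂ))) :
    commutator (FundamentalGroup ({0}ᶜ : Set (Fin 2 → ℂ)) z) = ⊤ := by
  have := pathConnectedSpace_compl_zero
  let φ : FundamentalGroup ({0}ᶜ : Set (Fin 2 → ℂ)) z →* Multiplicative
    (Additive (Abelianization (FundamentalGroup ({0}ᶜ : Set (Fin 2 → ℂ)) z))) := Abelianization.of
  obtain ⟨ψ, hψ, hφ⟩ := exists_isAdditiveOnPaths φ
  obtain ⟨c, hc, hcψ⟩ := hψ.exists_cocycle isOpen_compl_singleton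
  obtain ⟨u, hu⟩ := hc.exists_isPotential_compl_zero
  rw [eq_top_iff]
  intro g _
  obtain ⟨γ : Path z z, rfl⟩ := Path.Homotopic.Quotient.mk_surjective g
  have hzero : ψ γ = 0 := by
    have h2 := cocycleIntegral_eq (γ := γ) (c := fun x y : ({0}ᶜ : Set (Fin 2 → ℂ)) => c x y)
      (hu.comp (f := fun t => (γ t : Fin 2 → ℂ)) (T := Set.univ)
        (fun _ _ => (continuous_subtype_val.comp γ.continuous).continuousAt) fun t _ => (γ t).2)
    rw [← hcψ, h2]
    simp
  have h := hφ γ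
  rw [hzero] at h
  exact (QuotientGroup.eq_one_iff _).1 h.symm

end PuncturedPlane

section ProjectiveLine

/-- The determinant of two vectors in the plane. -/
def planeDet (u v : Fin 2 → ℂ) : ℂ := u 0 * v 1 - u 1 * v 0

theorem exists_smul_eq_of_planeDet_eq_zero {u v : Fin 2 → ℂ} (hv : v ≠ 0)
    (h : planeDet u v = 0) : ∃ c : ℂ, c • v = u := by
  unfold planeDet at h
  by_cases h0 : v 0 = 0
  · have h1 : v 1 ≠ 0 := fun h1 => hv (by ext i; fin_cases i <;> simp [h0, h1])
    have hu : u 0 = 0 := by simpa [h0, h1] using h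
    refine ⟨u 1 / v 1, ?_⟩
    ext i
    fin_cases i
    · simp [h0, hu]
    · simp [h1]
  · refine ⟨u 0 / v 0, ?_⟩
    ext i
    fin_cases i
    · simp [h0]
    · simp only [Fin.mk_one, Pi.smul_apply, smul_eq_mul]
      field_simp
      linear_combination h

theorem mk_eq_mk_iff_planeDet {u v : Fin 2 → ℂ} (hu : u ≠ 0) (hv : v ≠ 0) :
    Projectivization.mk ℂ u hu = Projectivization.mk ℂ v hv ↔ planeDet u v = 0 := by
  rw [Projectivization.mk_eq_mk_iff']
  constructor
  · rintro ⟨a, rfl⟩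
    simp [planeDet]; ring
  · exact exists_smul_eq_of_planeDet_eq_zero hv

theorem continuous_projectivization_mk {Y : Type*} [TopologicalSpace Y] {f : Y → Fin 2 → ℂ}
    (hf : Continuous f) (h : ∀ y, f y ≠ 0) :
    Continuous fun y => (Projectivization.mk ℂ (f y) (h y) : CP 1) :=
  continuous_quotient_mk'.comp (hf.subtype_mk h)

/-- Near a point of the projective line, homogeneous coordinates can be chosen continuously. -/
theorem exists_continuousAt_lift {v : Fin 2 → ℂ} (hv : v ≠ 0) :
    ∃ s : CP 1 → Fin 2 → ℂ, ContinuousAt s (Projectivization.mk ℂ v hv) ∧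
      s (Projectivization.mk ℂ v hv) = v ∧
      ∀ᶠ x in 𝓝 (Projectivization.mk ℂ v hv), ∃ h : s x ≠ 0, Projectivization.mk ℂ (s x) h = x := by
  obtain ⟨l, hl⟩ := SeparatingDual.exists_eq_one (R := ℂ) hv
  let s : CP 1 → Fin 2 → ℂ := Projectivization.lift (fun w => (l w)⁻¹ • (w : Fin 2 → ℂ)) <| by
    rintro ⟨a, ha⟩ ⟨b, hb⟩ c (rfl : a = c • b)
    have hc : c ≠ 0 := fun h => ha (by simp [h])
    simp only [map_smul, smul_eq_mul, mul_inv, smul_smul]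
    congr 1
    field_simp
  have hs (w : Fin 2 → ℂ) (hw : w ≠ 0) : s (Projectivization.mk ℂ w hw) = (l w)⁻¹ • w := rfl
  have hq : Topology.IsQuotientMap (fun w : {w : Fin 2 → ℂ // w ≠ 0} =>
    (Projectivization.mk ℂ w.1 w.2 : CP 1)) := isQuotientMap_quotient_mk'
  have hO : IsOpen {x : CP 1 | l (s x) ≠ 0} := by
    rw [← hq.isOpen_preimage]
    have : (fun w : {w : Fin 2 → ℂ // w ≠ 0} => (Projectivization.mk ℂ w.1 w.2 : CP 1)) ⁻¹'
        {x : CP 1 | l (s x) ≠ 0} = {w | l w.1 ≠ 0} := by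
      ext w
      simp [hs]
    rw [this]
    exact isOpen_ne.preimage (by fun_prop)
  have hmem : Projectivization.mk ℂ v hv ∈ {x : CP 1 | l (s x) ≠ 0} := by simp [hs, hl]
  have hcont : ContinuousOn s {x : CP 1 | l (s x) ≠ 0} := by
    rw [hq.continuousOn_isOpen_iff hO]
    change ContinuousOn (fun w : {w : Fin 2 → ℂ // w ≠ 0} => (l w.1)⁻¹ • w.1) _
    intro w hw
    have hlw : l w.1 ≠ 0 := by simpa [hs] using hw
    exact (ContinuousAt.smul (f := fun w : {w : Fin 2 → ℂ // w ≠ 0} => (l w.1)⁻¹)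
      (ContinuousAt.inv₀ (by fun_prop) hlw)
      continuous_subtype_val.continuousAt).continuousWithinAt
  refine ⟨s, hcont.continuousAt (hO.mem_nhds hmem), by simp [hs, hl], ?_⟩
  filter_upwards [hO.mem_nhds hmem] with x hx
  have hsx : s x ≠ 0 := fun h => hx (by simp [h])
  refine ⟨hsx, ?_⟩
  induction x using Projectivization.ind with | h w hw
  rw [Projectivization.mk_eq_mk_iff']
  exact ⟨(l w)⁻¹, rfl⟩

theorem mem_Fconf_one_one_iff {n : ℕ} {x : Fin (n + 2) → CP 1} :
    x ∈ Fconf (n + 2) 1 1 ↔ Function.Injective x := by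
  refine ⟨fun h => h.1, fun h => ⟨h, ?_⟩⟩
  refine le_antisymm ((Submodule.finrank_le _).trans (by simp)) ?_
  have hli : LinearIndependent ℂ ![(x 0).rep, (x 1).rep] := by
    rw [LinearIndependent.pair_iff' (Projectivization.rep_nonzero _)]
    intro a ha
    refine (by simp : (1 : Fin (n + 2)) ≠ 0) (h ?_)
    rw [← (x 0).mk_rep, ← (x 1).mk_rep, Projectivization.mk_eq_mk_iff']
    exact ⟨a, ha⟩
  have := finrank_span_eq_card hli
  rw [Fintype.card_fin] at this
  refine this.ge.trans (Submodule.finrank_mono (span_mono ?_))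
  rintro _ ⟨i, rfl⟩
  fin_cases i
  · exact ⟨0, rfl⟩
  · exact ⟨1, rfl⟩

end ProjectiveLine

section NormalizedConfiguration

variable {m : ℕ}

/-- Affine coordinates of the points of a normalized configuration: the first two points are `0`
and `1`. -/
def affineCoord (z : Fin m → ℂ) : Fin (m + 2) → ℂ := Fin.cons 0 (Fin.cons 1 z)

/-- Linear part of `affineCoord`. -/
def affineCoordLinear (a : Fin (m + 2)) : (Fin m → ℂ) →L[ℂ] ℂ :=
  (Fin.cons 0 (Fin.cons 0 fun i => ContinuousLinearMap.proj i) :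
    Fin (m + 2) → (Fin m → ℂ) →L[ℂ] ℂ) a

/-- Pairs of indices of points of a normalized configuration, without the two fixed points. -/
abbrev PairIndex (m : ℕ) := Σ j : Fin m, Fin (j + 2)

/-- The second index of a pair. -/
def PairIndex.snd (q : PairIndex m) : Fin (m + 2) := Fin.castLE (by omega) q.2

/-- Linear parts of the equations of the diagonals. -/
def diagonalLinear (q : PairIndex m) : (Fin m → ℂ) →L[ℂ] ℂ :=
  ContinuousLinearMap.proj q.1 - affineCoordLinear q.snd

/-- Constant parts of the equations of the diagonals. -/
def diagonalConst (q : PairIndex m) : ℂ := - affineCoord 0 q.snd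

/-- Normalized configurations of `m + 2` points in the affine line. -/
abbrev NormalizedConf (m : ℕ) : Set (Fin m → ℂ) :=
  arrangementCompl (diagonalLinear (m := m)) diagonalConst Finset.univ

@[simp]
theorem affineCoord_zero (z : Fin m → ℂ) : affineCoord z 0 = 0 := rfl

@[simp]
theorem affineCoord_one (z : Fin m → ℂ) : affineCoord z 1 = 1 := rfl

@[simp]
theorem affineCoord_succ_succ (z : Fin m → ℂ) (i : Fin m) : affineCoord z i.succ.succ = z i := rfl

theorem affineCoord_eq (z : Fin m → ℂ) (a : Fin (m + 2)) :
    affineCoord z a = affineCoordLinear a z + affineCoord 0 a := by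
  refine Fin.cases ?_ (fun a => Fin.cases ?_ (fun a => ?_) a) a <;>
    simp [affineCoord, affineCoordLinear]

theorem continuous_affineCoord (a : Fin (m + 2)) :
    Continuous fun z : Fin m → ℂ => affineCoord z a := by
  rw [funext fun z : Fin m → ℂ => affineCoord_eq z a]
  fun_prop

theorem diagonal_apply (q : PairIndex m) (z : Fin m → ℂ) :
    diagonalLinear q z + diagonalConst q = affineCoord z q.1.succ.succ - affineCoord z q.snd := by
  rw [affineCoord_eq z q.snd, affineCoord_succ_succ, diagonalLinear, diagonalConst]
  simp only [sub_apply, ContinuousLinearMap.proj_apply]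
  ring

theorem PairIndex.snd_lt (q : PairIndex m) : q.snd < q.1.succ.succ := by
  have := q.2.2
  simp only [PairIndex.snd, Fin.lt_def, Fin.val_castLE, Fin.val_succ]
  omega

theorem mem_normalizedConf_iff {z : Fin m → ℂ} :
    z ∈ NormalizedConf m ↔ Function.Injective (affineCoord z) := by
  simp only [NormalizedConf, arrangementCompl, Finset.mem_univ, true_imp_iff, Set.mem_ofPred_eq,
    diagonal_apply, sub_ne_zero]
  constructor
  · intro h
    have key (a b : Fin (m + 2)) (hab : a < b) : affineCoord z a ≠ affineCoord z b := by
      induction b using Fin.cases with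
      | zero => exact absurd hab (Fin.not_lt_zero a)
      | succ b =>
        induction b using Fin.cases with
        | zero =>
          have : a = 0 := by
            rw [Fin.lt_def] at hab
            ext
            simpa using hab
          subst this
          simp
        | succ b =>
          have ha : (a : ℕ) < b + 2 := hab
          exact (h ⟨b, ⟨a, ha⟩⟩).symm
    intro a b hab
    by_contra hne
    rcases lt_or_gt_of_ne hne with h' | h'
    · exact key a b h' hab
    · exact key b a h' hab.symm
  · intro h q hq
    exact q.snd_lt.ne' (h hq)

theorem diagonalLinear_ne_zero (q : PairIndex m) : diagonalLinear q ≠ 0 := by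
  intro h
  have h1 := DFunLike.congr_fun h (Pi.single q.1 1)
  have h2 := q.snd_lt
  rw [diagonalLinear] at h1
  revert h1 h2
  generalize q.snd = a
  refine Fin.cases ?_ (fun a => Fin.cases ?_ (fun a => ?_) a) a
  · simp [affineCoordLinear]
  · simp [affineCoordLinear]
  · intro h1 h2
    have : a ≠ q.1 := by
      rintro rfl
      exact lt_irrefl _ h2
    simp [affineCoordLinear, this] at h1

theorem exists_mem_one_diagonal (q : PairIndex m) :
    ∃ y, diagonalLinear q y + diagonalConst q = 0 ∧
      ∀ q', q' ≠ q → diagonalLinear q' y + diagonalConst q' ≠ 0 := by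
  let y : Fin m → ℂ := Function.update (fun i => ((i + 2 : ℕ) : ℂ)) q.1 ((q.2 : ℕ) : ℂ)
  have hval (a : Fin (m + 2)) (ha : a ≠ q.1.succ.succ) : affineCoord y a = ((a : ℕ) : ℂ) := by
    revert ha
    refine Fin.cases ?_ (fun a => Fin.cases ?_ (fun a => ?_) a) a
    · simp
    · simp
    · intro ha
      have : a ≠ q.1 := fun h => ha (by rw [h])
      simp [y, this]
      ring
  have hq : affineCoord y q.1.succ.succ = ((q.2 : ℕ) : ℂ) := by simp [y]
  refine ⟨y, ?_, fun q' hne => ?_⟩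
  · rw [diagonal_apply, hq, hval _ q.snd_lt.ne]
    simp [PairIndex.snd]
  · rw [diagonal_apply, sub_ne_zero]
    have hlt := q'.snd_lt
    by_cases h1 : q'.1 = q.1
    · obtain ⟨j, a⟩ := q
      obtain ⟨j', a'⟩ := q'
      obtain rfl : j' = j := h1
      rw [hq, hval _ hlt.ne]
      simp only [PairIndex.snd, Fin.val_castLE, ne_eq, Nat.cast_inj]
      intro h
      exact hne (by rw [Fin.ext h])
    · have h2 : q'.1.succ.succ ≠ q.1.succ.succ := fun h => h1 (by simpa using h)
      rw [hval _ h2]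
      by_cases h3 : q'.snd = q.1.succ.succ
      · rw [h3, hq, Ne, Nat.cast_inj]
        have := q.2.2
        rw [h3, Fin.lt_def] at hlt
        simp only [Fin.val_succ] at hlt ⊢
        omega
      · rw [hval _ h3, Ne, Nat.cast_inj]
        exact (Fin.lt_def.1 hlt).ne'

theorem card_pairIndex (m : ℕ) : Fintype.card (PairIndex m) = (m + 2).choose 2 - 1 := by
  rw [Fintype.card_sigma]
  simp only [Fintype.card_fin]
  rw [Fin.sum_univ_eq_sum_range (fun j => j + 2)]
  suffices h : ∑ j ∈ Finset.range m, (j + 2) + 1 = (m + 2).choose 2 by omega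
  induction m with
  | zero => rfl
  | succ m ih =>
    rw [Finset.sum_range_succ, Nat.choose_succ_succ' (m + 2) 1, ← ih, Nat.choose_one_right]
    omega

end NormalizedConfiguration

section Frame

open ComplexConjugate

variable {n : ℕ}

/-- The squared Hermitian norm of a vector in the plane. -/
def planeNormSq (v : Fin 2 → ℂ) : ℂ := v 0 * conj (v 0) + v 1 * conj (v 1)

/-- The vectors `u` with `planeDet v u = 1`, parametrized by a complex number. -/
def secondVector (v : Fin 2 → ℂ) (t : ℂ) : Fin 2 → ℂ :=
  ![t * v 0 - conj (v 1) / planeNormSq v, t * v 1 + conj (v 0) / planeNormSq v]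

/-- The parameter of a vector `u` with `planeDet v u = 1`. -/
def frameParam (v u : Fin 2 → ℂ) : ℂ := (conj (v 0) * u 0 + conj (v 1) * u 1) / planeNormSq v

theorem planeNormSq_ne_zero {v : Fin 2 → ℂ} (hv : v ≠ 0) : planeNormSq v ≠ 0 := by
  rw [planeNormSq, Complex.mul_conj, Complex.mul_conj, ← Complex.ofReal_add, Complex.ofReal_ne_zero]
  intro h
  have h0 := Complex.normSq_nonneg (v 0)
  have h1 := Complex.normSq_nonneg (v 1)
  refine hv (funext fun i => ?_)
  fin_cases i
  · exact Complex.normSq_eq_zero.1 (le_antisymm (show Complex.normSq (v 0) ≤ 0 by linarith) h0)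
  · exact Complex.normSq_eq_zero.1 (le_antisymm (show Complex.normSq (v 1) ≤ 0 by linarith) h1)

theorem planeDet_secondVector {v : Fin 2 → ℂ} (hv : v ≠ 0) (t : ℂ) :
    planeDet v (secondVector v t) = 1 := by
  have h := planeNormSq_ne_zero hv
  simp only [planeDet, secondVector, Matrix.cons_val_zero, Matrix.cons_val_one]
  field_simp
  rw [planeNormSq]
  ring

theorem frameParam_secondVector {v : Fin 2 → ℂ} (hv : v ≠ 0) (t : ℂ) :
    frameParam v (secondVector v t) = t := by
  have h := planeNormSq_ne_zero hv
  simp only [frameParam, secondVector, Matrix.cons_val_zero, Matrix.cons_val_one]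
  field_simp
  rw [planeNormSq]
  ring

theorem ne_zero_of_planeDet_eq_one {v u : Fin 2 → ℂ} (h : planeDet v u = 1) : v ≠ 0 := by
  rintro rfl
  simp [planeDet] at h

theorem secondVector_frameParam {v u : Fin 2 → ℂ} (h : planeDet v u = 1) :
    secondVector v (frameParam v u) = u := by
  have hN := planeNormSq_ne_zero (ne_zero_of_planeDet_eq_one h)
  rw [planeDet] at h
  ext i
  fin_cases i
  · simp only [secondVector, frameParam, Fin.zero_eta, Matrix.cons_val_zero]
    field_simp
    rw [planeNormSq]
    linear_combination (conj (v 1)) * h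
  · simp only [secondVector, frameParam, Fin.mk_one, Matrix.cons_val_one, Matrix.cons_val_zero]
    field_simp
    rw [planeNormSq]
    linear_combination (-conj (v 0)) * h

theorem continuous_secondVector :
    Continuous fun p : ({0}ᶜ : Set (Fin 2 → ℂ)) × ℂ => secondVector p.1 p.2 := by
  have hN (p : ({0}ᶜ : Set (Fin 2 → ℂ)) × ℂ) : planeNormSq p.1 ≠ 0 := planeNormSq_ne_zero p.1.2
  have hv (i : Fin 2) : Continuous fun p : ({0}ᶜ : Set (Fin 2 → ℂ)) × ℂ => (p.1 : Fin 2 → ℂ) i :=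
    (continuous_apply i).comp (continuous_subtype_val.comp continuous_fst)
  have hs (i : Fin 2) :
      Continuous fun p : ({0}ᶜ : Set (Fin 2 → ℂ)) × ℂ => conj ((p.1 : Fin 2 → ℂ) i) :=
    Complex.continuous_conj.comp (hv i)
  have hc : Continuous fun p : ({0}ᶜ : Set (Fin 2 → ℂ)) × ℂ => planeNormSq p.1 :=
    ((hv 0).mul (hs 0)).add ((hv 1).mul (hs 1))
  refine continuous_pi fun i => ?_
  fin_cases i
  · exact (continuous_snd.mul (hv 0)).sub ((hs 1).div hc hN)
  · exact (continuous_snd.mul (hv 1)).add ((hs 0).div hc hN)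

theorem ContinuousAt.frameParam {X : Type*} [TopologicalSpace X] {v u : X → Fin 2 → ℂ} {x : X}
    (hv : ContinuousAt v x) (hu : ContinuousAt u x) (h : v x ≠ 0) :
    ContinuousAt (fun y => frameParam (v y) (u y)) x := by
  have hvi := continuousAt_pi.1 hv
  have hui := continuousAt_pi.1 hu
  have hs (i : Fin 2) : ContinuousAt (fun y => conj (v y i)) x :=
    Complex.continuous_conj.continuousAt.comp (hvi i)
  exact (((hs 0).mul (hui 0)).add ((hs 1).mul (hui 1))).div
    (((hvi 0).mul (hs 0)).add ((hvi 1).mul (hs 1))) (planeNormSq_ne_zero h)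

theorem ContinuousAt.planeDet {X : Type*} [TopologicalSpace X] {v u : X → Fin 2 → ℂ} {x : X}
    (hv : ContinuousAt v x) (hu : ContinuousAt u x) :
    ContinuousAt (fun y => planeDet (v y) (u y)) x := by
  have hvi := continuousAt_pi.1 hv
  have hui := continuousAt_pi.1 hu
  exact ((hvi 0).mul (hui 1)).sub ((hvi 1).mul (hui 0))

/-- Homogeneous coordinates of the points with affine coordinates `∞` and `w` in the frame
`(v, u)`. -/
def confVector (v u : Fin 2 → ℂ) (w : Fin n → ℂ) : Fin (n + 1) → Fin 2 → ℂ :=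
  Fin.cons u fun a => v + w a • u

/-- The affine coordinates of points of the projective line, given by homogeneous coordinates, for
which the first three points are `∞`, `0` and `1`. -/
def crossRatio (V : Fin (n + 3) → Fin 2 → ℂ) (a : Fin (n + 2)) : ℂ :=
  planeDet (V 2) (V 0) * planeDet (V 1) (V a.succ) /
    (planeDet (V 1) (V 2) * planeDet (V a.succ) (V 0))

theorem planeDet_confVector {v u : Fin 2 → ℂ} (h : planeDet v u = 1) {w : Fin n → ℂ}
    (hw : Function.Injective w) {i j : Fin (n + 1)} (hij : i ≠ j) :
    planeDet (confVector v u w i) (confVector v u w j) ≠ 0 := by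
  rw [planeDet] at h
  induction i using Fin.cases with
  | zero =>
    induction j using Fin.cases with
    | zero => exact absurd rfl hij
    | succ b =>
      have : planeDet u (v + w b • u) = -1 := by
        simp only [planeDet, Pi.add_apply, Pi.smul_apply, smul_eq_mul]
        linear_combination -h
      simp [confVector, this]
  | succ a =>
    induction j using Fin.cases with
    | zero =>
      have : planeDet (v + w a • u) u = 1 := by
        simp only [planeDet, Pi.add_apply, Pi.smul_apply, smul_eq_mul]
        linear_combination h
      simp [confVector, this]
    | succ b =>
      have : planeDet (v + w a • u) (v + w b • u) = w b - w a := by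
        simp only [planeDet, Pi.add_apply, Pi.smul_apply, smul_eq_mul]
        linear_combination (w b - w a) * h
      simp only [confVector, Fin.cons_succ, this]
      exact sub_ne_zero.2 fun e => hij (by rw [hw e])

theorem confVector_ne_zero {v u : Fin 2 → ℂ} (h : planeDet v u = 1) (w : Fin n → ℂ)
    (i : Fin (n + 1)) : confVector v u w i ≠ 0 := by
  rw [planeDet] at h
  induction i using Fin.cases with
  | zero =>
    simp only [confVector, Fin.cons_zero]
    rintro rfl
    simp at h
  | succ a =>
    simp only [confVector, Fin.cons_succ]
    intro e
    have h0 := congrFun e 0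
    have h1 := congrFun e 1
    simp only [Pi.add_apply, Pi.smul_apply, smul_eq_mul, Pi.zero_apply] at h0 h1
    refine one_ne_zero (α := ℂ) ?_
    linear_combination -h + u 1 * h0 - u 0 * h1

/-- Vectors whose classes are pairwise distinct points of the projective line. -/
def IsGeneric (V : Fin n → Fin 2 → ℂ) : Prop := ∀ i j, i ≠ j → planeDet (V i) (V j) ≠ 0

theorem Fin.one_ne_two_add_three : (1 : Fin (n + 3)) ≠ 2 := fun h => by
  simpa using Fin.succ_injective _ (show Fin.succ (0 : Fin (n + 2)) = Fin.succ 1 from h)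

theorem crossRatio_zero (V : Fin (n + 3) → Fin 2 → ℂ) : crossRatio V 0 = 0 := by
  have : planeDet (V 1) (V 1) = 0 := by simp [planeDet, mul_comm]
  simp [crossRatio, this]

theorem crossRatio_one {V : Fin (n + 3) → Fin 2 → ℂ} (hV : IsGeneric V) : crossRatio V 1 = 1 := by
  have h20 := hV 2 0 (Fin.succ_ne_zero (1 : Fin (n + 2)))
  have h12 := hV 1 2 Fin.one_ne_two_add_three
  have : (Fin.succ 1 : Fin (n + 3)) = 2 := rfl
  rw [crossRatio, this]
  field_simp

theorem affineCoord_crossRatio {V : Fin (n + 3) → Fin 2 → ℂ} (hV : IsGeneric V) :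
    affineCoord (fun i => crossRatio V i.succ.succ) = crossRatio V := by
  ext a
  refine Fin.cases ?_ (fun a => Fin.cases ?_ (fun a => ?_) a) a
  · rw [affineCoord_zero, crossRatio_zero]
  · exact (crossRatio_one hV).symm
  · rw [affineCoord_succ_succ]

theorem crossRatio_injective {V : Fin (n + 3) → Fin 2 → ℂ} (hV : IsGeneric V) :
    Function.Injective (crossRatio V) := by
  intro a b h
  by_contra hab
  have h20 := hV 2 0 (Fin.succ_ne_zero (1 : Fin (n + 2)))
  have h12 := hV 1 2 Fin.one_ne_two_add_three
  have h10 := hV 1 0 (Fin.succ_ne_zero (0 : Fin (n + 2)))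
  have ha := hV a.succ 0 (Fin.succ_ne_zero a)
  have hb := hV b.succ 0 (Fin.succ_ne_zero b)
  have hdet := hV a.succ b.succ fun e => hab (Fin.succ_injective _ e)
  rw [crossRatio, crossRatio, div_eq_div_iff (mul_ne_zero h12 ha) (mul_ne_zero h12 hb)] at h
  have h' : planeDet (V 1) (V a.succ) * planeDet (V b.succ) (V 0) =
      planeDet (V 1) (V b.succ) * planeDet (V a.succ) (V 0) :=
    mul_left_cancel₀ (mul_ne_zero h20 h12) (by linear_combination h)
  refine mul_ne_zero h10 hdet ?_
  simp only [planeDet] at h' ⊢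
  linear_combination -h'

theorem crossRatio_smul {V V' : Fin (n + 3) → Fin 2 → ℂ} {c : Fin (n + 3) → ℂ}
    (hc : ∀ j, c j ≠ 0) (h : ∀ j, V' j = c j • V j) : crossRatio V' = crossRatio V := by
  have hd (i j) : planeDet (V' i) (V' j) = c i * c j * planeDet (V i) (V j) := by
    simp only [planeDet, h, Pi.smul_apply, smul_eq_mul]
    ring
  ext a
  simp only [crossRatio, hd]
  have h0 := hc 0
  have h1 := hc 1
  have h2 := hc 2
  have ha := hc a.succ
  rw [show c 2 * c 0 * planeDet (V 2) (V 0) * (c 1 * c a.succ * planeDet (V 1) (V a.succ)) =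
    (c 0 * c 1 * c 2 * c a.succ) * (planeDet (V 2) (V 0) * planeDet (V 1) (V a.succ)) by ring,
    show c 1 * c 2 * planeDet (V 1) (V 2) * (c a.succ * c 0 * planeDet (V a.succ) (V 0)) =
    (c 0 * c 1 * c 2 * c a.succ) * (planeDet (V 1) (V 2) * planeDet (V a.succ) (V 0)) by ring]
  exact mul_div_mul_left _ _ (by positivity)

theorem crossRatio_confVector {v u : Fin 2 → ℂ} (h : planeDet v u = 1) (z : Fin n → ℂ) :
    crossRatio (confVector v u (affineCoord z)) = affineCoord z := by
  ext a
  have e0 : confVector v u (affineCoord z) 0 = u := rfl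
  have e1 : confVector v u (affineCoord z) 1 = v + (0 : ℂ) • u := rfl
  have e2 : confVector v u (affineCoord z) 2 = v + (1 : ℂ) • u := rfl
  have ea : confVector v u (affineCoord z) a.succ = v + affineCoord z a • u := rfl
  rw [planeDet] at h
  have d20 : planeDet (v + (1 : ℂ) • u) u = 1 := by
    simp only [planeDet, Pi.add_apply, Pi.smul_apply, smul_eq_mul]
    linear_combination h
  have d12 : planeDet (v + (0 : ℂ) • u) (v + (1 : ℂ) • u) = 1 := by
    simp only [planeDet, Pi.add_apply, Pi.smul_apply, smul_eq_mul]
    linear_combination h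
  have d1a : planeDet (v + (0 : ℂ) • u) (v + affineCoord z a • u) = affineCoord z a := by
    simp only [planeDet, Pi.add_apply, Pi.smul_apply, smul_eq_mul]
    linear_combination affineCoord z a * h
  have da0 : planeDet (v + affineCoord z a • u) u = 1 := by
    simp only [planeDet, Pi.add_apply, Pi.smul_apply, smul_eq_mul]
    linear_combination h
  rw [crossRatio, e0, e1, e2, ea, d20, d12, d1a, da0]
  simp

theorem ContinuousAt.crossRatio {X : Type*} [TopologicalSpace X]
    {V : X → Fin (n + 3) → Fin 2 → ℂ} {x : X} (hV : ContinuousAt V x) (hg : IsGeneric (V x))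
    (a : Fin (n + 2)) : ContinuousAt (fun y => crossRatio (V y) a) x := by
  have hj (j) : ContinuousAt (fun y => V y j) x := continuousAt_pi.1 hV j
  exact ((ContinuousAt.planeDet (hj _) (hj _)).mul (ContinuousAt.planeDet (hj _) (hj _))).div
    ((ContinuousAt.planeDet (hj _) (hj _)).mul (ContinuousAt.planeDet (hj _) (hj _)))
    (mul_ne_zero (hg _ _ Fin.one_ne_two_add_three) (hg _ _ (Fin.succ_ne_zero a)))

end Frame

section ConfigurationCover

variable {m : ℕ}

/-- `V` is a family of homogeneous coordinates of the configuration `x`. -/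
def IsLift {n : ℕ} (V : Fin n → Fin 2 → ℂ) (x : Fin n → CP 1) : Prop :=
  ∀ j, ∃ h : V j ≠ 0, Projectivization.mk ℂ (V j) h = x j

theorem isLift_rep {n : ℕ} (x : Fin n → CP 1) : IsLift (fun j => (x j).rep) x :=
  fun j => ⟨(x j).rep_nonzero, (x j).mk_rep⟩

theorem IsLift.isGeneric {n : ℕ} {V : Fin n → Fin 2 → ℂ} {x : Fin n → CP 1} (h : IsLift V x)
    (hx : Function.Injective x) : IsGeneric V := by
  intro i j hij h0
  obtain ⟨hi, ei⟩ := h i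
  obtain ⟨hj, ej⟩ := h j
  exact hij (hx (by rw [← ei, ← ej, mk_eq_mk_iff_planeDet, h0]))

theorem IsLift.crossRatio_eq {n : ℕ} {V V' : Fin (n + 3) → Fin 2 → ℂ} {x : Fin (n + 3) → CP 1}
    (h : IsLift V x) (h' : IsLift V' x) : crossRatio V' = crossRatio V := by
  have : ∀ j, ∃ c : ℂ, c ≠ 0 ∧ V' j = c • V j := by
    intro j
    obtain ⟨hj, ej⟩ := h j
    obtain ⟨hj', ej'⟩ := h' j
    obtain ⟨c, hc⟩ := (Projectivization.mk_eq_mk_iff' ℂ _ _ hj' hj).1 (ej'.trans ej.symm)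
    exact ⟨c, fun h0 => hj' (by rw [← hc, h0, zero_smul]), hc.symm⟩
  choose c hc hV using this
  exact crossRatio_smul hc hV

theorem exists_continuousAt_isLift {n : ℕ} {V₀ : Fin n → Fin 2 → ℂ} {x₀ : Fin n → CP 1}
    (h : IsLift V₀ x₀) : ∃ V : (Fin n → CP 1) → Fin n → Fin 2 → ℂ,
      ContinuousAt V x₀ ∧ V x₀ = V₀ ∧ ∀ᶠ x in 𝓝 x₀, IsLift (V x) x := by
  have : ∀ j, ∃ s : CP 1 → Fin 2 → ℂ, ContinuousAt s (x₀ j) ∧ s (x₀ j) = V₀ j ∧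
      ∀ᶠ x in 𝓝 (x₀ j), ∃ h : s x ≠ 0, Projectivization.mk ℂ (s x) h = x := by
    intro j
    obtain ⟨hj, ej⟩ := h j
    rw [← ej]
    exact exists_continuousAt_lift hj
  choose s hs hsV hev using this
  have hap (j) : ContinuousAt (fun x : Fin n → CP 1 => x j) x₀ := (continuous_apply j).continuousAt
  refine ⟨fun x j => s j (x j), continuousAt_pi.2 fun j =>
    ContinuousAt.comp (f := fun x : Fin n → CP 1 => x j) (hs j) (hap j), funext hsV, ?_⟩
  exact Filter.eventually_all.2 fun j => (hap j).eventually (hev j)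

/-- The double cover of the configuration space of the projective line: a unimodular frame of the
plane together with a normalized configuration. -/
def ConfCover (m : ℕ) := ({0}ᶜ : Set (Fin 2 → ℂ)) × ℂ × NormalizedConf m

instance : TopologicalSpace (ConfCover m) :=
  inferInstanceAs (TopologicalSpace (({0}ᶜ : Set (Fin 2 → ℂ)) × ℂ × NormalizedConf m))

theorem planeDet_confCover (e : ConfCover m) : planeDet e.1 (secondVector e.1 e.2.1) = 1 :=
  planeDet_secondVector e.1.2 _

/-- Homogeneous coordinates of the configuration under a point of the cover. -/
def coverVector (e : ConfCover m) : Fin (m + 3) → Fin 2 → ℂ :=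
  confVector e.1 (secondVector e.1 e.2.1) (affineCoord e.2.2)

theorem coverVector_ne_zero (e : ConfCover m) (j) : coverVector e j ≠ 0 :=
  confVector_ne_zero (planeDet_confCover e) _ j

/-- The covering map onto the configuration space. -/
def coverMap (e : ConfCover m) : Fconf (m + 2 + 1) 1 1 :=
  ⟨fun j => Projectivization.mk ℂ (coverVector e j) (coverVector_ne_zero e j), by
    refine mem_Fconf_one_one_iff.2 fun i j h => ?_
    by_contra hij
    rw [mk_eq_mk_iff_planeDet] at h
    exact planeDet_confVector (planeDet_confCover e) (mem_normalizedConf_iff.1 e.2.2.2) hij h⟩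

theorem isLift_coverVector (e : ConfCover m) : IsLift (coverVector e) (coverMap e).1 :=
  fun j => ⟨coverVector_ne_zero e j, rfl⟩

theorem continuous_coverMap : Continuous (coverMap (m := m)) := by
  refine Continuous.subtype_mk (continuous_pi fun j => continuous_projectivization_mk ?_ _) _
  have hv : Continuous fun e : ConfCover m => (e.1 : Fin 2 → ℂ) :=
    continuous_subtype_val.comp continuous_fst
  have hu : Continuous fun e : ConfCover m => secondVector e.1 e.2.1 :=
    continuous_secondVector.comp (continuous_fst.prodMk (continuous_fst.comp continuous_snd))
  induction j using Fin.cases with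
  | zero => exact hu
  | succ a =>
    have hw : Continuous fun e : ConfCover m => affineCoord (e.2.2 : Fin m → ℂ) a :=
      (continuous_affineCoord a).comp
        (continuous_subtype_val.comp (continuous_snd.comp continuous_snd))
    exact hv.add (hw.smul hu)

/-- The normalization of a configuration by a projective transformation. -/
def normalizeConf (x : Fconf (m + 2 + 1) 1 1) : NormalizedConf m :=
  ⟨fun i => crossRatio (fun j => (x.1 j).rep) i.succ.succ, by
    have hg := (isLift_rep x.1).isGeneric x.2.1
    rw [mem_normalizedConf_iff, affineCoord_crossRatio hg]
    exact crossRatio_injective hg⟩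

theorem affineCoord_normalizeConf {x : Fconf (m + 2 + 1) 1 1} {V : Fin (m + 3) → Fin 2 → ℂ}
    (h : IsLift V x.1) : affineCoord (normalizeConf x).1 = crossRatio V := by
  rw [(isLift_rep x.1).crossRatio_eq h]
  have hg := (isLift_rep x.1).isGeneric x.2.1
  rw [← affineCoord_crossRatio hg]
  rfl

theorem affineCoord_injective : Function.Injective (affineCoord (m := m)) := fun _ _ h =>
  funext fun i => congrFun h i.succ.succ

theorem normalizeConf_coverMap (e : ConfCover m) : normalizeConf (coverMap e) = e.2.2 :=
  Subtype.ext (affineCoord_injective (by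
    rw [affineCoord_normalizeConf (isLift_coverVector e)]
    exact crossRatio_confVector (planeDet_confCover e) _))

theorem continuous_normalizeConf : Continuous (normalizeConf (m := m)) := by
  refine Continuous.subtype_mk (continuous_pi fun i => continuous_iff_continuousAt.2 fun x => ?_) _
  obtain ⟨V, hV, hVx, hev⟩ := exists_continuousAt_isLift (isLift_rep x.1)
  have hV' : ContinuousAt (fun y : Fconf (m + 2 + 1) 1 1 => V y.1) x :=
    ContinuousAt.comp hV continuous_subtype_val.continuousAt
  have hg : IsGeneric (V x.1) := by
    rw [hVx]
    exact (isLift_rep x.1).isGeneric x.2.1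
  refine (ContinuousAt.crossRatio hV' hg i.succ.succ).congr ?_
  filter_upwards [continuous_subtype_val.continuousAt.eventually hev] with y hy
  exact congrFun ((isLift_rep y.1).crossRatio_eq hy) _

theorem coverMap_eq {x : Fconf (m + 2 + 1) 1 1} {V : Fin (m + 3) → Fin 2 → ℂ} (h : IsLift V x.1)
    {s : ℂ} (hs : s ^ 2 = planeDet (V 2) (V 0) * planeDet (V 1) (V 2) * planeDet (V 1) (V 0))
    {v u : Fin 2 → ℂ} (hv : v = (planeDet (V 2) (V 0) / s) • V 1)
    (hu : u = (planeDet (V 1) (V 2) / s) • V 0) :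
    ∃ hv0 : v ≠ 0, coverMap (⟨v, hv0⟩, frameParam v u, normalizeConf x) = x := by
  have hg := h.isGeneric x.2.1
  have h20 := hg 2 0 (Fin.succ_ne_zero (1 : Fin (m + 2)))
  have h12 := hg 1 2 Fin.one_ne_two_add_three
  have h10 := hg 1 0 (Fin.succ_ne_zero (0 : Fin (m + 2)))
  have hs0 : s ≠ 0 := by
    rintro rfl
    exact mul_ne_zero (mul_ne_zero h20 h12) h10 (by rw [← hs]; simp)
  have hdet : planeDet v u = 1 := by
    have : planeDet v u = planeDet (V 2) (V 0) * planeDet (V 1) (V 2) * planeDet (V 1) (V 0) /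
        s ^ 2 := by
      rw [hv, hu]
      generalize planeDet (V 2) (V 0) = α
      generalize planeDet (V 1) (V 2) = β
      simp only [planeDet, Pi.smul_apply, smul_eq_mul]
      field_simp
    rw [this, hs, div_self (mul_ne_zero (mul_ne_zero h20 h12) h10)]
  have hv0 := ne_zero_of_planeDet_eq_one hdet
  refine ⟨hv0, Subtype.ext (funext fun j => ?_)⟩
  obtain ⟨hj, ej⟩ := h j
  rw [← ej]
  refine (mk_eq_mk_iff_planeDet _ _).2 ?_
  change planeDet (confVector v (secondVector v (frameParam v u)) (affineCoord (normalizeConf x).1) j)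
    (V j) = 0
  rw [secondVector_frameParam hdet, affineCoord_normalizeConf h]
  induction j using Fin.cases with
  | zero =>
    simp only [confVector, Fin.cons_zero, hu, planeDet, Pi.smul_apply, smul_eq_mul]
    ring
  | succ a =>
    have ha := hg a.succ 0 (Fin.succ_ne_zero a)
    have : planeDet (v + crossRatio V a • u) (V a.succ) =
        planeDet (V 2) (V 0) / s * planeDet (V 1) (V a.succ) -
          crossRatio V a * (planeDet (V 1) (V 2) / s * planeDet (V a.succ) (V 0)) := by
      rw [hv, hu]
      generalize planeDet (V 2) (V 0) = α
      generalize planeDet (V 1) (V 2) = β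
      simp only [planeDet, Pi.add_apply, Pi.smul_apply, smul_eq_mul]
      ring
    simp only [confVector, Fin.cons_succ]
    rw [this, crossRatio]
    field_simp
    ring

theorem coverMap_surjective : Function.Surjective (coverMap (m := m)) := by
  intro x
  have h := isLift_rep x.1
  obtain ⟨s, hs⟩ := IsAlgClosed.exists_pow_nat_eq (planeDet (x.1 2).rep (x.1 0).rep *
    planeDet (x.1 1).rep (x.1 2).rep * planeDet (x.1 1).rep (x.1 0).rep) two_pos
  obtain ⟨hv0, he⟩ := coverMap_eq h hs rfl rfl
  exact ⟨_, he⟩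

theorem isOpenMap_coverMap : IsOpenMap (coverMap (m := m)) := by
  refine isOpenMap_iff_nhds_le.2 fun e U hU => ?_
  have hemb : Topology.IsInducing fun e : ConfCover m => ((e.1 : Fin 2 → ℂ), e.2) :=
    Topology.IsInducing.subtypeVal.prodMap Topology.IsInducing.id
  rw [Filter.mem_map, hemb.nhds_eq_comap, Filter.mem_comap] at hU
  obtain ⟨U', hU', hUU⟩ := hU
  set x := coverMap e with hx
  obtain ⟨V, hV, hVx, hev⟩ := exists_continuousAt_isLift (isLift_coverVector e)
  have hV' (j) : ContinuousAt (fun y : Fconf (m + 2 + 1) 1 1 => V y.1 j) x :=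
    continuousAt_pi.1 (ContinuousAt.comp (g := V) hV continuous_subtype_val.continuousAt) j
  have hα : ContinuousAt (fun y : Fconf (m + 2 + 1) 1 1 => planeDet (V y.1 2) (V y.1 0)) x :=
    (hV' 2).planeDet (hV' 0)
  have hβ : ContinuousAt (fun y : Fconf (m + 2 + 1) 1 1 => planeDet (V y.1 1) (V y.1 2)) x :=
    (hV' 1).planeDet (hV' 2)
  have hγ : ContinuousAt (fun y : Fconf (m + 2 + 1) 1 1 => planeDet (V y.1 1) (V y.1 0)) x :=
    (hV' 1).planeDet (hV' 0)
  have hdet := planeDet_confCover e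
  have e0 : V x.1 0 = secondVector e.1 e.2.1 := by rw [hVx]; rfl
  have e1 : V x.1 1 = e.1 := by
    rw [hVx]
    change (e.1 : Fin 2 → ℂ) + (0 : ℂ) • secondVector e.1 e.2.1 = _
    rw [zero_smul, add_zero]
  have e2 : V x.1 2 = e.1 + secondVector e.1 e.2.1 := by
    rw [hVx]
    change (e.1 : Fin 2 → ℂ) + (1 : ℂ) • secondVector e.1 e.2.1 = _
    rw [one_smul]
  have hα1 : planeDet (V x.1 2) (V x.1 0) = 1 := by
    rw [e0, e2, ← hdet]; simp only [planeDet, Pi.add_apply]; ring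
  have hβ1 : planeDet (V x.1 1) (V x.1 2) = 1 := by
    rw [e1, e2, ← hdet]; simp only [planeDet, Pi.add_apply]; ring
  have hγ1 : planeDet (V x.1 1) (V x.1 0) = 1 := by rw [e0, e1, hdet]
  let δ (y : Fconf (m + 2 + 1) 1 1) : ℂ :=
    planeDet (V y.1 2) (V y.1 0) * planeDet (V y.1 1) (V y.1 2) * planeDet (V y.1 1) (V y.1 0)
  have hδ1 : δ x = 1 := by simp only [δ, hα1, hβ1, hγ1, mul_one]
  let s (y : Fconf (m + 2 + 1) 1 1) : ℂ := δ y ^ (((2 : ℕ) : ℂ)⁻¹)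
  have hs1 : s x = 1 := by simp only [s, hδ1, Complex.one_cpow]
  have hs : ContinuousAt s x :=
    ContinuousAt.cpow (f := δ) ((hα.mul hβ).mul hγ) continuousAt_const
      (by rw [hδ1]; exact Complex.one_mem_slitPlane)
  let v (y : Fconf (m + 2 + 1) 1 1) := (planeDet (V y.1 2) (V y.1 0) / s y) • V y.1 1
  let u (y : Fconf (m + 2 + 1) 1 1) := (planeDet (V y.1 1) (V y.1 2) / s y) • V y.1 0
  have hs0 : s x ≠ 0 := by simp [hs1]
  have hv : ContinuousAt v x := (hα.div hs hs0).smul (hV' 1)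
  have hu : ContinuousAt u x := (hβ.div hs hs0).smul (hV' 0)
  have hvx : v x = e.1 := by simp only [v, hα1, hs1, div_one, one_smul, e1]
  have hux : u x = secondVector e.1 e.2.1 := by simp only [u, hβ1, hs1, div_one, one_smul, e0]
  have hF : ContinuousAt (fun y => (v y, frameParam (v y) (u y), normalizeConf y)) x :=
    hv.prodMk ((hv.frameParam hu (by rw [hvx]; exact e.1.2)).prodMk
      continuous_normalizeConf.continuousAt)
  have hFx : (v x, frameParam (v x) (u x), normalizeConf x) = ((e.1 : Fin 2 → ℂ), e.2) := by
    rw [hvx, hux, frameParam_secondVector e.1.2, hx, normalizeConf_coverMap]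
  have hmem : ∀ᶠ y in 𝓝 x, (v y, frameParam (v y) (u y), normalizeConf y) ∈ U' :=
    hF.eventually (by beta_reduce; rw [hFx]; exact hU')
  filter_upwards [hmem, continuous_subtype_val.continuousAt.eventually hev] with y hy hlift
  obtain ⟨hv0, he⟩ := coverMap_eq hlift (s := s y) (Complex.cpow_nat_inv_pow _ two_ne_zero)
    (v := v y) (u := u y) rfl rfl
  rw [← he]
  exact hUU hy

end ConfigurationCover

section ConfigurationCovering

variable {m : ℕ}

/-- The sign change of the frame acts on the cover. -/
instance : MulAction ℤˣ (ConfCover m) where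
  smul g e := (⟨g • (e.1 : Fin 2 → ℂ), (smul_ne_zero_iff_ne g).2 e.1.2⟩, e.2)
  one_smul e := Prod.ext (Subtype.ext (one_smul ℤˣ (e.1 : Fin 2 → ℂ))) rfl
  mul_smul g h e := Prod.ext (Subtype.ext (mul_smul g h (e.1 : Fin 2 → ℂ))) rfl

theorem coe_units_smul_fst (g : ℤˣ) (e : ConfCover m) :
    ((g • e).1 : Fin 2 → ℂ) = g • (e.1 : Fin 2 → ℂ) := rfl

theorem units_smul_snd (g : ℤˣ) (e : ConfCover m) : (g • e).2 = e.2 := rfl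

instance : ContinuousConstSMul ℤˣ (ConfCover m) where
  continuous_const_smul g := by
    refine Continuous.prodMk (Continuous.subtype_mk ?_ _) continuous_snd
    exact (continuous_const_smul g).comp (continuous_subtype_val.comp continuous_fst)

theorem secondVector_neg (v : Fin 2 → ℂ) (t : ℂ) : secondVector (-v) t = -secondVector v t := by
  ext i
  fin_cases i <;> simp [secondVector, planeNormSq] <;> ring

theorem coverVector_neg_one_smul (e : ConfCover m) (j : Fin (m + 3)) :
    coverVector ((-1 : ℤˣ) • e) j = -coverVector e j := by
  have h : (((-1 : ℤˣ) • e).1 : Fin 2 → ℂ) = -(e.1 : Fin 2 → ℂ) := by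
    rw [coe_units_smul_fst, Units.smul_def]
    simp
  rw [coverVector, coverVector, units_smul_snd, h, secondVector_neg]
  induction j using Fin.cases with
  | zero => rfl
  | succ a =>
    simp only [confVector, Fin.cons_succ]
    module

theorem coverMap_units_smul (g : ℤˣ) (e : ConfCover m) : coverMap (g • e) = coverMap e := by
  obtain rfl | rfl := Int.units_eq_one_or g
  · rw [one_smul]
  · refine Subtype.ext (funext fun j => (Projectivization.mk_eq_mk_iff' ℂ _ _ _ _).2 ⟨-1, ?_⟩)
    rw [coverVector_neg_one_smul, neg_one_smul]

theorem eq_or_eq_neg_of_frame {v v' u u' : Fin 2 → ℂ} (h : planeDet v u = 1)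
    (h' : planeDet v' u' = 1) {a b c : ℂ} (hu : a • u' = u) (hv : b • v' = v)
    (hvu : c • (v' + u') = v + u) : (v = v' ∧ u = u') ∨ (v = -v' ∧ u = -u') := by
  subst hu hv
  have hb : b = c := by
    have := congrArg (planeDet · u') hvu
    simp only [planeDet, Pi.add_apply, Pi.smul_apply, smul_eq_mul] at this h'
    linear_combination (c - b) * h' - this
  have ha : a = c := by
    have := congrArg (planeDet v' ·) hvu
    simp only [planeDet, Pi.add_apply, Pi.smul_apply, smul_eq_mul] at this h'
    linear_combination (c - a) * h' - this
  subst ha hb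
  have hsq : b ^ 2 = 1 := by
    simp only [planeDet, Pi.smul_apply, smul_eq_mul] at h h'
    linear_combination h - b ^ 2 * h'
  obtain rfl | rfl := mul_self_eq_one_iff.1 ((sq b).symm.trans hsq)
  · simp
  · simp

theorem mem_orbit_of_coverMap_eq {e e' : ConfCover m} (h : coverMap e = coverMap e') :
    e ∈ MulAction.orbit ℤˣ e' := by
  have key (j) : ∃ c : ℂ, c • coverVector e' j = coverVector e j :=
    (Projectivization.mk_eq_mk_iff' ℂ _ _ _ _).1 (congrFun (congrArg Subtype.val h) j)
  obtain ⟨a, ha⟩ := key 0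
  obtain ⟨b, hb⟩ := key 1
  obtain ⟨c, hc⟩ := key 2
  have hz : e.2.2 = e'.2.2 := by rw [← normalizeConf_coverMap, h, normalizeConf_coverMap]
  have h1 (e : ConfCover m) : coverVector e 1 = e.1 := by
    change (e.1 : Fin 2 → ℂ) + (0 : ℂ) • secondVector e.1 e.2.1 = _
    rw [zero_smul, add_zero]
  have h2 (e : ConfCover m) : coverVector e 2 = e.1 + secondVector e.1 e.2.1 := by
    change (e.1 : Fin 2 → ℂ) + (1 : ℂ) • secondVector e.1 e.2.1 = _
    rw [one_smul]
  rw [h1, h1] at hb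
  rw [h2, h2] at hc
  have ht {g : ℤˣ} (hv : (e.1 : Fin 2 → ℂ) = g • (e'.1 : Fin 2 → ℂ))
      (hu : secondVector e.1 e.2.1 = secondVector (g • (e'.1 : Fin 2 → ℂ)) e'.2.1) :
      e ∈ MulAction.orbit ℤˣ e' := by
    refine ⟨g, Prod.ext (Subtype.ext hv.symm) (Prod.ext ?_ hz.symm)⟩
    have hne : g • (e'.1 : Fin 2 → ℂ) ≠ 0 := by rw [← hv]; exact e.1.2
    rw [hv] at hu
    change e'.2.1 = e.2.1
    rw [← frameParam_secondVector hne e'.2.1, ← hu, frameParam_secondVector hne]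
  obtain ⟨hv, hu⟩ | ⟨hv, hu⟩ := eq_or_eq_neg_of_frame (planeDet_confCover e)
    (planeDet_confCover e') ha hb hc
  · exact ht (g := 1) (by rw [one_smul, hv]) (by rw [one_smul, hu])
  · have hn : (-1 : ℤˣ) • (e'.1 : Fin 2 → ℂ) = -(e'.1 : Fin 2 → ℂ) := by
      rw [Units.smul_def]
      simp
    exact ht (g := -1) (by rw [hn, hv]) (by rw [hn, hu, secondVector_neg])

theorem isQuotientCoveringMap_coverMap : IsQuotientCoveringMap (coverMap (m := m)) ℤˣ where
  toIsQuotientMap := isOpenMap_coverMap.isQuotientMap continuous_coverMap coverMap_surjective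
  continuous_const_smul := continuous_const_smul
  apply_eq_iff_mem_orbit {e e'} := by
    refine ⟨mem_orbit_of_coverMap_eq, ?_⟩
    rintro ⟨g, rfl⟩
    exact coverMap_units_smul g e'
  disjoint e := by
    have hc : Continuous fun e : ConfCover m => (e.1 : Fin 2 → ℂ) :=
      continuous_subtype_val.comp continuous_fst
    refine ⟨_, hc.continuousAt.preimage_mem_nhds
      (Metric.ball_mem_nhds (e.1 : Fin 2 → ℂ) (norm_pos_iff.2 e.1.2)), ?_⟩
    rintro g ⟨_, ⟨y, hy, rfl⟩, hgy⟩
    refine (Int.units_eq_one_or g).resolve_right ?_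
    rintro rfl
    have hn : (((-1 : ℤˣ) • y).1 : Fin 2 → ℂ) = -(y.1 : Fin 2 → ℂ) := by
      rw [coe_units_smul_fst, Units.smul_def]
      simp
    simp only [Set.mem_preimage, Metric.mem_ball, dist_eq_norm] at hy hgy
    rw [hn] at hgy
    have h2 : ‖(2 : ℝ) • (e.1 : Fin 2 → ℂ)‖ ≤
        ‖(y.1 : Fin 2 → ℂ) - e.1‖ + ‖-(y.1 : Fin 2 → ℂ) - e.1‖ := by
      rw [← norm_neg ((2 : ℝ) • (e.1 : Fin 2 → ℂ))]
      refine le_trans (le_of_eq (congrArg _ ?_)) (norm_add_le _ _)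
      module
    rw [norm_smul] at h2
    norm_num at h2
    linarith

end ConfigurationCovering

section FundamentalGroupProduct

variable {X Y Z : Type*} [TopologicalSpace X] [TopologicalSpace Y] [TopologicalSpace Z]

theorem FundamentalGroup.mapOfEq_rfl (f : C(X, Y)) (x : X) :
    FundamentalGroup.mapOfEq f (rfl : f x = f x) = FundamentalGroup.map f x := by
  ext γ
  rw [FundamentalGroup.mapOfEq_apply]
  induction γ using Path.Homotopic.Quotient.ind
  rfl

theorem FundamentalGroup.mapOfEq_map {f : C(X, Y)} {g : C(Y, Z)} {q : C(X, Z)} (hq : g.comp f = q)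
    {x : X} (h : g (f x) = q x) (γ : FundamentalGroup X x) :
    FundamentalGroup.mapOfEq g h (FundamentalGroup.map f x γ) = FundamentalGroup.map q x γ := by
  subst hq
  rw [FundamentalGroup.mapOfEq_rfl]
  induction γ using Path.Homotopic.Quotient.ind
  rfl

theorem FundamentalGroup.map_mem_commutator (f : C(X, Y)) (x : X) {γ : FundamentalGroup X x}
    (h : γ ∈ commutator (FundamentalGroup X x)) :
    FundamentalGroup.map f x γ ∈ commutator (FundamentalGroup Y (f x)) := by
  have : (commutator (FundamentalGroup X x)).map (FundamentalGroup.map f x) ≤ commutator _ := by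
    rw [commutator_def, Subgroup.map_commutator, commutator_def]
    exact Subgroup.commutator_mono le_top le_top
  exact this ⟨γ, h, rfl⟩

theorem FundamentalGroup.eq_mul_map_prod (x : X) (y : Y) (γ : FundamentalGroup (X × Y) (x, y)) :
    γ = FundamentalGroup.map ⟨fun b => (x, b), by fun_prop⟩ y
          (FundamentalGroup.map ContinuousMap.snd (x, y) γ) *
        FundamentalGroup.map ⟨fun a => (a, y), by fun_prop⟩ x
          (FundamentalGroup.map ContinuousMap.fst (x, y) γ) := by
  have h := Path.Homotopic.comp_prod_eq_prod_comp (Path.Homotopic.projLeft γ)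
    (Path.Homotopic.Quotient.refl y) (Path.Homotopic.Quotient.refl x) (Path.Homotopic.projRight γ)
  rw [Path.Homotopic.Quotient.trans_refl, Path.Homotopic.Quotient.refl_trans,
    Path.Homotopic.prod_projLeft_projRight] at h
  rw [FundamentalGroup.mul_def]
  refine h.symm.trans ?_
  clear h
  induction γ using Path.Homotopic.Quotient.ind
  rfl

theorem FundamentalGroup.mem_commutator_prod (p : X × Y) {γ : FundamentalGroup (X × Y) p}
    (h₁ : FundamentalGroup.map ContinuousMap.fst p γ ∈ commutator (FundamentalGroup X p.1))
    (h₂ : FundamentalGroup.map ContinuousMap.snd p γ ∈ commutator (FundamentalGroup Y p.2)) :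
    γ ∈ commutator (FundamentalGroup (X × Y) p) := by
  obtain ⟨x, y⟩ := p
  rw [FundamentalGroup.eq_mul_map_prod x y γ]
  exact mul_mem (FundamentalGroup.map_mem_commutator ⟨fun b => (x, b), by fun_prop⟩ y h₂)
    (FundamentalGroup.map_mem_commutator ⟨fun a => (a, y), by fun_prop⟩ x h₁)

end FundamentalGroupProduct

/-- A surjective homomorphism to a commutative group whose kernel is contained in the
commutator subgroup identifies the abelianization. -/
def abelianizationEquivOfKerLe {G T : Type*} [Group G] [CommGroup T] (f : G →* T)
    (hf : Function.Surjective f) (hker : f.ker ≤ commutator G) : Abelianization G ≃* T :=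
  (QuotientGroup.quotientMulEquivOfEq
    (le_antisymm (Abelianization.commutator_subset_ker f) hker)).trans
    (QuotientGroup.quotientKerEquivOfSurjective f hf)

section ConfigurationHomology

variable {m : ℕ}

theorem pathConnectedSpace_confCover (e : ConfCover m) : PathConnectedSpace (ConfCover m) := by
  have := pathConnectedSpace_compl_zero
  have : PathConnectedSpace (NormalizedConf m) := isPathConnected_iff_pathConnectedSpace.1
    (isPathConnected_arrangementCompl _ _ _ ⟨_, e.2.2.2⟩)
  exact inferInstanceAs (PathConnectedSpace (({0}ᶜ : Set (Fin 2 → ℂ)) × ℂ × NormalizedConf m))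

/-- The winding numbers of a loop of configurations around the diagonals, after normalization. -/
def confWindingHom (e : ConfCover m) : FundamentalGroup (Fconf (m + 2 + 1) 1 1) (coverMap e) →*
    (PairIndex m → Multiplicative ℤ) :=
  (windingHom diagonalLinear diagonalConst e.2.2).comp
    (FundamentalGroup.mapOfEq ⟨normalizeConf, continuous_normalizeConf⟩ (normalizeConf_coverMap e))

theorem confWindingHom_map (e : ConfCover m) (γ : FundamentalGroup (ConfCover m) e) :
    confWindingHom e (FundamentalGroup.map ⟨coverMap, continuous_coverMap⟩ e γ) =
      windingHom diagonalLinear diagonalConst e.2.2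
        (FundamentalGroup.map ⟨fun e : ConfCover m => e.2.2, continuous_snd.comp continuous_snd⟩
          e γ) :=
  congrArg (windingHom diagonalLinear diagonalConst e.2.2) (FundamentalGroup.mapOfEq_map
    (f := ⟨coverMap, continuous_coverMap⟩) (g := ⟨normalizeConf, continuous_normalizeConf⟩)
    (q := ⟨fun e : ConfCover m => e.2.2, continuous_snd.comp continuous_snd⟩)
    (ContinuousMap.ext normalizeConf_coverMap) (normalizeConf_coverMap e) γ)

/-- The monodromy of the double cover together with the winding numbers. -/
def confHomologyHom (e : ConfCover m) : FundamentalGroup (Fconf (m + 2 + 1) 1 1) (coverMap e) →*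
    ℤˣᵐᵒᵖ × (PairIndex m → Multiplicative ℤ) :=
  (isQuotientCoveringMap_coverMap.fundamentalGroupToMulOpposite ⟨e, rfl⟩).prod (confWindingHom e)

theorem mem_ker_monodromy_iff (e : ConfCover m)
    (γ : FundamentalGroup (Fconf (m + 2 + 1) 1 1) (coverMap e)) :
    isQuotientCoveringMap_coverMap.fundamentalGroupToMulOpposite ⟨e, rfl⟩ γ = 1 ↔
      ∃ γ', FundamentalGroup.map ⟨coverMap, continuous_coverMap⟩ e γ' = γ := by
  rw [← MonoidHom.mem_ker, isQuotientCoveringMap_coverMap.ker_fundamentalGroupToMulOpposite,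
    isQuotientCoveringMap_coverMap.ker_monodromyPerm ⟨e, rfl⟩, MonoidHom.mem_range]
  have := FundamentalGroup.mapOfEq_rfl ⟨coverMap, continuous_coverMap⟩ e
  exact exists_congr fun γ' => by rw [← this]

theorem confHomologyHom_surjective (e : ConfCover m) :
    Function.Surjective (confHomologyHom e) := by
  rintro ⟨a, w⟩
  have := pathConnectedSpace_confCover e
  obtain ⟨γ, hγ⟩ :=
    isQuotientCoveringMap_coverMap.fundamentalGroupToMulOpposite_surjective ⟨e, rfl⟩ a
  obtain ⟨δ, hδ⟩ := windingHom_surjective diagonalLinear diagonalConst diagonalLinear_ne_zero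
    exists_mem_one_diagonal e.2.2 ((confWindingHom e γ)⁻¹ * w)
  let i : C(NormalizedConf m, ConfCover m) := ⟨fun z => (e.1, e.2.1, z), by
    exact continuous_const.prodMk (continuous_const.prodMk continuous_id)⟩
  let δ' : FundamentalGroup (ConfCover m) e := FundamentalGroup.map i e.2.2 δ
  have hδ' : confWindingHom e (FundamentalGroup.map ⟨coverMap, continuous_coverMap⟩ e δ') =
      (confWindingHom e γ)⁻¹ * w := by
    rw [confWindingHom_map, ← hδ]
    congr 1
    simp only [δ']
    clear hδ δ'
    induction δ using Path.Homotopic.Quotient.ind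
    rfl
  refine ⟨γ * FundamentalGroup.map ⟨coverMap, continuous_coverMap⟩ e δ', Prod.ext ?_ ?_⟩
  · change isQuotientCoveringMap_coverMap.fundamentalGroupToMulOpposite ⟨e, rfl⟩ _ = a
    rw [map_mul, hγ, (mem_ker_monodromy_iff e _).2 ⟨δ', rfl⟩, mul_one]
  · change confWindingHom e _ = w
    rw [map_mul, hδ', mul_inv_cancel_left]

theorem ker_confHomologyHom_le (e : ConfCover m) : (confHomologyHom e).ker ≤ commutator _ := by
  intro γ hγ
  have h₁ : isQuotientCoveringMap_coverMap.fundamentalGroupToMulOpposite ⟨e, rfl⟩ γ = 1 :=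
    congrArg Prod.fst hγ
  have h₂ : confWindingHom e γ = 1 := congrArg Prod.snd hγ
  obtain ⟨γ', rfl⟩ := (mem_ker_monodromy_iff e γ).1 h₁
  rw [confWindingHom_map] at h₂
  have h₃ := ker_windingHom_le diagonalLinear diagonalConst diagonalLinear_ne_zero e.2.2 h₂
  have hℂ (t : ℂ) (δ : FundamentalGroup ℂ t) : δ ∈ commutator (FundamentalGroup ℂ t) := by
    rw [Subsingleton.elim δ 1]
    exact one_mem _
  refine FundamentalGroup.map_mem_commutator ⟨coverMap, continuous_coverMap⟩ e
    (FundamentalGroup.mem_commutator_prod (X := ({0}ᶜ : Set (Fin 2 → ℂ)))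
      (Y := ℂ × NormalizedConf m) e ?_
      (FundamentalGroup.mem_commutator_prod (X := ℂ) (Y := NormalizedConf m) e.2 ?_ ?_))
  · rw [commutator_fundamentalGroup_compl_zero]
    exact Subgroup.mem_top _
  · exact hℂ _ _
  · convert h₃ using 1
    clear h₁ h₂ h₃ hγ
    induction γ' using Path.Homotopic.Quotient.ind
    rfl

theorem nonempty_additive_signs_prod_equiv {ι : Type*} [Fintype ι] {N : ℕ}
    (h : Fintype.card ι = N) : Nonempty (Additive (ℤˣᵐᵒᵖ × (ι → Multiplicative ℤ)) ≃+
      (Fin N → ℤ) × ZMod 2) := by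
  have : Fact (Nat.Prime 2) := ⟨Nat.prime_two⟩
  let signs : Additive ℤˣᵐᵒᵖ ≃+ ZMod 2 := addEquivOfPrimeCardEq (p := 2)
    (by rw [Nat.card_congr (Additive.toMul.trans MulOpposite.opEquiv.symm)]; simp) (by simp)
  let indices : ι ≃ Fin N := Fintype.equivFinOfCardEq h
  let integers : Additive (ι → Multiplicative ℤ) ≃+ (Fin N → ℤ) :=
    { toFun := fun f j => (f.toMul (indices.symm j)).toAdd
      invFun := fun f => Additive.ofMul fun i => Multiplicative.ofAdd (f (indices i))
      left_inv := fun f => by ext; simp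
      right_inv := fun f => by ext; simp
      map_add' := fun _ _ => rfl }
  exact ⟨((AddEquiv.prodAdditive _ _).trans (signs.prodCongr integers)).trans AddEquiv.prodComm⟩

end ConfigurationHomology

end Auxiliary

/-- For `k ≥ 2`, the abelianization of `π₁(F_{k+1}^{1,1})` (which is the first homology
group of this path-connected space) is isomorphic to `ℤ^(C(k,2) - 1) × ℤ/2ℤ`. -/
theorem H1_Fconf_one_one (k : ℕ) (hk : 2 ≤ k) (x : Fconf (k + 1) 1 1) :
    Nonempty (Additive (Abelianization (FundamentalGroup (Fconf (k + 1) 1 1) x)) ≃+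
      ((Fin (k.choose 2 - 1) → ℤ) × ZMod 2)) := by
  obtain ⟨m, rfl⟩ := Nat.exists_eq_add_of_le' hk
  obtain ⟨e, rfl⟩ := coverMap_surjective x
  obtain ⟨φ⟩ := nonempty_additive_signs_prod_equiv (card_pairIndex m)
  exact ⟨(MulEquiv.toAdditive (abelianizationEquivOfKerLe _ (confHomologyHom_surjective e)
    (ker_confHomologyHom_le e))).trans φ⟩
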